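/- arXiv:0708.3257 — 5 statements merged into one kernel-verified Lean document; each statement's English description precedes it below -/
import Mathlib

section
/- Fix an odd integer q = 2h+3 with h ≥ 2 (i.e. q ≥ 7), let λ = 2·cos(π/q) and H_q = 1/(2·√((1 − λ/2)² + 1)). Then D = {(t,v) ∈ Ω : t < 0, v > H_q/(1 − H_q·t), and v > (|t| − H_q)/(H_q·t)}, and D has exactly four connected components. -/
noncomputable section

open Real Filter Topology MeasureTheory
open scoped Classical

namespace RosenTong

/-- `λ_q = 2 cos(π/q)`. -/
def lam (q : ℕ) : ℝ := 2 * Real.cos (Real.pi / q)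

/-- The Rosen map `f_q` on `[-λ/2, λ/2)`. -/
def f (l : ℝ) (x : ℝ) : ℝ :=
  if x = 0 then 0 else 1 / |x| - l * (⌊1 / (l * |x|) + 1 / 2⌋ : ℝ)

/-- `x` is `G_q`-irrational: its Rosen orbit never hits `0`. -/
def Irr (l : ℝ) (x : ℝ) : Prop := ∀ n : ℕ, (f l)^[n] x ≠ 0

/-- `ε_n = sign (f^{n-1} x)` (for `n ≥ 1`). -/
def eps (l x : ℝ) (n : ℕ) : ℝ := Real.sign ((f l)^[n - 1] x)

/-- `r_n = ⌊1/(λ |f^{n-1} x|) + 1/2⌋` (for `n ≥ 1`), as a real number. -/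
def rr (l x : ℝ) (n : ℕ) : ℝ := (⌊1 / (l * |(f l)^[n - 1] x|) + 1 / 2⌋ : ℝ)

/-- `((R_{n-1}, R_n), (S_{n-1}, S_n))`. -/
def RS (l x : ℝ) : ℕ → (ℝ × ℝ) × (ℝ × ℝ)
  | 0 => ((1, 0), (0, 1))
  | n + 1 =>
      (((RS l x n).1.2, rr l x (n + 1) * l * (RS l x n).1.2 + eps l x (n + 1) * (RS l x n).1.1),
       ((RS l x n).2.2, rr l x (n + 1) * l * (RS l x n).2.2 + eps l x (n + 1) * (RS l x n).2.1))

/-- Numerator `R_n` of the `n`-th Rosen convergent. -/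
def Rnum (l x : ℝ) (n : ℕ) : ℝ := (RS l x n).1.2

/-- Denominator `S_n` of the `n`-th Rosen convergent. -/
def Snum (l x : ℝ) (n : ℕ) : ℝ := (RS l x n).2.2

/-- The approximation coefficient `Θ_n = S_n² |x - R_n/S_n|`. -/
def theta (l x : ℝ) (n : ℕ) : ℝ := (Snum l x n) ^ 2 * |x - Rnum l x n / Snum l x n|

/-- The natural extension map `𝒯(x,y) = (f x, 1/(r(x)λ + ε(x) y))`. -/
def T (l : ℝ) (z : ℝ × ℝ) : ℝ × ℝ :=
  (f l z.1, 1 / ((⌊1 / (l * |z.1|) + 1 / 2⌋ : ℝ) * l + Real.sign z.1 * z.2))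

/-- `(t_n, v_n) = 𝒯^n (x, 0)`. -/
def tv (l x : ℝ) (n : ℕ) : ℝ × ℝ := (T l)^[n] (x, 0)

/-- `G(y) = -1/(λ + y)`. -/
def G (l : ℝ) (y : ℝ) : ℝ := -1 / (l + y)

/-- `C(y) = -1/(2λ + y)`. -/
def CC (l : ℝ) (y : ℝ) : ℝ := -1 / (2 * l + y)

/-- `τ_k` in the even case `q = 2p`. -/
def tauE (l : ℝ) (p : ℕ) : ℕ → ℝ
  | 0 => -2 / (3 * l)
  | k + 1 => -1 / (2 * l + (G l)^[p - 2] (tauE l p k))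

/-- `τ_k` in the odd case `q = 2h+3`. -/
def tauO (l : ℝ) (h : ℕ) : ℕ → ℝ
  | 0 => -2 / (3 * l)
  | k + 1 => CC l ((G l)^[h] (CC l ((G l)^[h - 1] (tauO l h k))))

/-- `φ_j = f^j(-λ/2)`. -/
def phi (l : ℝ) (j : ℕ) : ℝ := (f l)^[j] (-(l / 2))

/-- The heights `L_j` in the even case: `L_1 = 1/(λ+1)`, `L_j = 1/(λ - L_{j-1})`. -/
def LE (l : ℝ) : ℕ → ℝ
  | 0 => 0
  | 1 => 1 / (l + 1)
  | j + 2 => 1 / (l - LE l (j + 1))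

/-- The natural extension domain `Ω` in the even case `q = 2p`. -/
def OmegaE (l : ℝ) (p : ℕ) : Set (ℝ × ℝ) :=
  (⋃ j ∈ Finset.Icc 1 (p - 1),
    (Set.Ico (phi l (j - 1)) (phi l j)) ×ˢ (Set.Icc 0 (LE l j)))
  ∪ (Set.Ico (0 : ℝ) (l / 2)) ×ˢ (Set.Icc (0 : ℝ) 1)

/-- The region `D` (even case): both `Θ_{n-1}` and `Θ_n` exceed `1/2`. -/
def DE (l : ℝ) (p : ℕ) : Set (ℝ × ℝ) :=
  {z ∈ OmegaE l p | z.2 / (1 + z.1 * z.2) > 1 / 2 ∧ |z.1| / (1 + z.1 * z.2) > 1 / 2}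

/-- The region `A = {(t,v) ∈ D : -2/(3λ) ≤ t ≤ -1/(λ+1)}`. -/
def AE (l : ℝ) (p : ℕ) : Set (ℝ × ℝ) :=
  {z ∈ DE l p | -2 / (3 * l) ≤ z.1 ∧ z.1 ≤ -1 / (l + 1)}

/-- `A_k = {(t,v) ∈ A : t ≥ τ_k}`. -/
def AEk (l : ℝ) (p k : ℕ) : Set (ℝ × ℝ) :=
  {z ∈ AE l p | tauE l p k ≤ z.1}

/-- The invariant measure `ν` (even case), with density `C_q/(1+tv)²` on `Ω`. -/
def nuE (q p : ℕ) : Measure (ℝ × ℝ) :=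
  (volume.restrict (OmegaE (lam q) p)).withDensity fun z =>
    ENNReal.ofReal
      ((1 / Real.log ((1 + Real.cos (Real.pi / q)) / Real.sin (Real.pi / q))) /
        (1 + z.1 * z.2) ^ 2)

/-- The Hurwitz constant `H_q` for odd `q`. -/
def Hodd (l : ℝ) : ℝ := 1 / (2 * Real.sqrt ((1 - l / 2) ^ 2 + 1) )

/-- The positive root `R` of `R² + (2-λ)R - 1 = 0` (odd case). -/
def Rodd (l : ℝ) : ℝ := (l - 2 + Real.sqrt ((2 - l) ^ 2 + 4)) / 2

/-- The Rosen map on a negative number whose first digit is `n`. -/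
lemma f_of_neg {l x : ℝ} (n : ℤ) (hx : x < 0) (h1 : (n : ℝ) ≤ 1 / (l * -x) + 1 / 2)
    (h2 : 1 / (l * -x) + 1 / 2 < n + 1) : f l x = -1 / x - l * n := by
  have hfl : ⌊1 / (l * -x) + 1 / 2⌋ = n := Int.floor_eq_iff.2 ⟨h1, h2⟩
  rw [f, if_neg hx.ne, abs_of_neg hx, hfl]
  congr 1
  rw [one_div, neg_div, one_div, inv_neg]

/-- The `i`-th point, in increasing order, of the orbit of `-λ/2`, where `λ = 2 cos (2α)`. -/
def orbitPt (α : ℝ) (i : ℕ) : ℝ := -(Real.cos ((i + 2 : ℕ) * α) / Real.cos (i * α))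

section OrbitPt

variable {h : ℕ} {α : ℝ}

lemma cos_mul_pos (hα0 : 0 < α) (hα : (2 * h + 3) * α = π / 2) {i : ℕ} (hi : i ≤ 2 * h + 2) :
    0 < Real.cos (i * α) := by
  have hi' : (i : ℝ) ≤ 2 * h + 2 := by exact_mod_cast hi
  have : 0 ≤ (i : ℝ) * α := by positivity
  apply Real.cos_pos_of_mem_Ioo
  constructor
  · linarith [Real.pi_pos]
  · nlinarith

lemma cos_add_four_mul (α : ℝ) (i : ℕ) : Real.cos ((i + 4 : ℕ) * α) =
    2 * Real.cos (2 * α) * Real.cos ((i + 2 : ℕ) * α) - Real.cos (i * α) := by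
  have h1 : ((i + 4 : ℕ) : ℝ) * α = (i + 2 : ℕ) * α + 2 * α := by push_cast; ring
  have h2 : (i : ℝ) * α = (i + 2 : ℕ) * α - 2 * α := by push_cast; ring
  rw [h1, h2, Real.cos_add, Real.cos_sub]
  ring

lemma orbitPt_add_two (hα0 : 0 < α) (hα : (2 * h + 3) * α = π / 2) {i : ℕ} (hi : i ≤ 2 * h) :
    orbitPt α (i + 2) = -1 / orbitPt α i - 2 * Real.cos (2 * α) := by
  have h1 := cos_mul_pos hα0 hα (i := i) (by omega)
  have h2 := cos_mul_pos hα0 hα (i := i + 2) (by omega)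
  have h3 := cos_add_four_mul α i
  rw [orbitPt, orbitPt, h3]
  generalize Real.cos ((i + 2 : ℕ) * α) = b at *
  field_simp
  ring

lemma orbitPt_lt_succ (hα0 : 0 < α) (hα : (2 * h + 3) * α = π / 2) {i : ℕ} (hi : i ≤ 2 * h) :
    orbitPt α i < orbitPt α (i + 1) := by
  have h1 := cos_mul_pos hα0 hα (i := i) (by omega)
  have h2 := cos_mul_pos hα0 hα (i := i + 1) (by omega)
  have hs : 0 < Real.sin α := Real.sin_pos_of_pos_of_lt_pi hα0 (by nlinarith [Real.pi_pos])
  have hs2 : 0 < Real.sin (2 * α) :=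
    Real.sin_pos_of_pos_of_lt_pi (by linarith) (by nlinarith [Real.pi_pos])
  unfold orbitPt
  rw [neg_lt_neg_iff, div_lt_div_iff₀ h2 h1]
  have e1 : ((i + 1 + 2 : ℕ) : ℝ) * α = (i + 1 : ℕ) * α + 2 * α := by push_cast; ring
  have e2 : ((i + 2 : ℕ) : ℝ) * α = (i : ℕ) * α + 2 * α := by push_cast; ring
  have e3 : Real.sin α = Real.sin ((i + 1 : ℕ) * α) * Real.cos (i * α)
      - Real.cos ((i + 1 : ℕ) * α) * Real.sin (i * α) := by
    rw [← Real.sin_sub]; congr 1; push_cast; ring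
  rw [e1, e2, Real.cos_add, Real.cos_add]
  nlinarith [mul_pos hs hs2]

lemma orbitPt_mono (hα0 : 0 < α) (hα : (2 * h + 3) * α = π / 2) {i j : ℕ} (hij : i ≤ j)
    (hj : j ≤ 2 * h + 1) : orbitPt α i ≤ orbitPt α j := by
  induction j, hij using Nat.le_induction with
  | base => exact le_rfl
  | succ j _ ih => exact (ih (by omega)).trans (orbitPt_lt_succ hα0 hα (by omega)).le

lemma orbitPt_zero (α : ℝ) : orbitPt α 0 = -(2 * Real.cos (2 * α) / 2) := by
  simp [orbitPt]

lemma orbitPt_one (hα0 : 0 < α) (hα : (2 * h + 3) * α = π / 2) :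
    orbitPt α 1 = 1 - 2 * Real.cos (2 * α) := by
  have h1 := cos_mul_pos hα0 hα (i := 1) (by omega)
  simp only [Nat.cast_one, one_mul] at h1
  simp only [orbitPt, Nat.cast_one, one_mul, Nat.reduceAdd, Nat.cast_ofNat]
  rw [Real.cos_three_mul, Real.cos_two_mul]
  field_simp
  ring

lemma orbitPt_last (hα : (2 * h + 3) * α = π / 2) : orbitPt α (2 * h + 1) = 0 := by
  have : ((2 * h + 1 + 2 : ℕ) : ℝ) * α = π / 2 := by rw [← hα]; push_cast; ring
  rw [orbitPt, this]
  simp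

lemma orbitPt_two_mul (hα0 : 0 < α) (hα : (2 * h + 3) * α = π / 2) :
    orbitPt α (2 * h) = -1 / (1 + 2 * Real.cos (2 * α)) := by
  have hs : 0 < Real.sin α := Real.sin_pos_of_pos_of_lt_pi hα0 (by nlinarith [Real.pi_pos])
  have h1 := cos_mul_pos hα0 hα (i := 2 * h) (by omega)
  have e1 : ((2 * h + 2 : ℕ) : ℝ) * α = π / 2 - α := by rw [← hα]; push_cast; ring
  have e2 : ((2 * h : ℕ) : ℝ) * α = π / 2 - 3 * α := by rw [← hα]; push_cast; ring
  rw [e2, Real.cos_pi_div_two_sub, Real.sin_three_mul] at h1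
  rw [orbitPt, e1, e2, Real.cos_pi_div_two_sub, Real.cos_pi_div_two_sub, Real.sin_three_mul,
    Real.cos_two_mul, Real.cos_sq']
  have h2 : 0 < 3 - 4 * Real.sin α ^ 2 := by
    by_contra hc
    nlinarith
  have h3 : 1 + 2 * (2 * (1 - Real.sin α ^ 2) - 1) = 3 - 4 * Real.sin α ^ 2 := by ring
  have h4 : 3 * Real.sin α - 4 * Real.sin α ^ 3 = Real.sin α * (3 - 4 * Real.sin α ^ 2) := by ring
  rw [h3, h4]
  field_simp

lemma orbitPt_two_mul_sub_one (hα0 : 0 < α) (hα : (2 * h + 3) * α = π / 2) (hh : 1 ≤ h) :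
    orbitPt α (2 * h - 1) = -1 / (2 * Real.cos (2 * α)) := by
  have h1 := orbitPt_add_two hα0 hα (i := 2 * h - 1) (by omega)
  rw [show 2 * h - 1 + 2 = 2 * h + 1 by omega, orbitPt_last hα] at h1
  have h2 : 2 * Real.cos (2 * α) = -1 / orbitPt α (2 * h - 1) := by linarith
  rw [h2, neg_div, neg_div, one_div_neg_eq_neg_one_div, neg_neg, one_div_one_div]

lemma f_orbitPt (hα0 : 0 < α) (hα : (2 * h + 3) * α = π / 2) (hl : 0 < Real.cos (2 * α))
    {i : ℕ} (hh : 1 ≤ h) (hi : i ≤ 2 * h - 1) :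
    f (2 * Real.cos (2 * α)) (orbitPt α i) = orbitPt α (i + 2) := by
  have h1 := orbitPt_mono hα0 hα hi (by omega)
  have h2 := orbitPt_mono hα0 hα (Nat.zero_le i) (by omega)
  rw [orbitPt_two_mul_sub_one hα0 hα hh, neg_div] at h1
  rw [orbitPt_zero] at h2
  rw [orbitPt_add_two hα0 hα (by omega)]
  have hl2 := Real.cos_le_one (2 * α)
  set x := orbitPt α i
  set l := 2 * Real.cos (2 * α)
  have hl0 : 0 < l := by positivity
  have hx : x < 0 := h1.trans_lt (by rw [neg_lt_zero]; positivity)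
  have hx1 : 1 ≤ l * -x := by
    have : 1 / l ≤ -x := by linarith
    rw [div_le_iff₀ hl0] at this; linarith
  have hp : 0 < l * -x := by linarith
  have h5 : l * -x ≤ 2 := by nlinarith
  rw [f_of_neg 1 hx]
  · simp
  · have : 1 / 2 ≤ 1 / (l * -x) := one_div_le_one_div_of_le hp h5
    push_cast; linarith
  · have : 1 / (l * -x) ≤ 1 := by rw [div_le_one hp]; exact hx1
    push_cast; linarith

lemma f_orbitPt_two_mul (hα0 : 0 < α) (hα : (2 * h + 3) * α = π / 2)
    (hl : 1 / 2 < Real.cos (2 * α)) :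
    f (2 * Real.cos (2 * α)) (orbitPt α (2 * h)) = orbitPt α 1 := by
  rw [orbitPt_two_mul hα0 hα, orbitPt_one hα0 hα]
  have hl2 := Real.cos_le_one (2 * α)
  set l := 2 * Real.cos (2 * α) with hldef
  have hl1 : 1 < l := by linarith
  have hx : -1 / (1 + l) < 0 := by rw [neg_div, neg_lt_zero]; positivity
  have e1 : 1 / (l * -(-1 / (1 + l))) = 1 + 1 / l := by field_simp; ring
  have h4 : 1 / l < 1 := by rw [div_lt_one (by linarith)]; exact hl1
  have h5 : 1 / 2 ≤ 1 / l := one_div_le_one_div_of_le (by linarith) (by linarith)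
  rw [f_of_neg 2 hx]
  · have : 1 + l ≠ 0 := by positivity
    field_simp
    push_cast
    ring
  · rw [e1]; push_cast; linarith
  · rw [e1]; push_cast; linarith

lemma phi_eq_orbitPt (hα0 : 0 < α) (hα : (2 * h + 3) * α = π / 2) (hl : 0 < Real.cos (2 * α))
    (hh : 1 ≤ h) {k : ℕ} (hk : k ≤ h) : phi (2 * Real.cos (2 * α)) k = orbitPt α (2 * k) := by
  induction k with
  | zero => simp [phi, orbitPt_zero]
  | succ k ih =>
    have := ih (by omega)
    rw [phi] at this ⊢
    rw [Function.iterate_succ_apply', this, f_orbitPt hα0 hα hl hh (by omega)]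
    rfl

lemma phi_add_eq_orbitPt (hα0 : 0 < α) (hα : (2 * h + 3) * α = π / 2)
    (hl : 1 / 2 < Real.cos (2 * α)) (hh : 1 ≤ h) {k : ℕ} (hk : k ≤ h) :
    phi (2 * Real.cos (2 * α)) (h + k + 1) = orbitPt α (2 * k + 1) := by
  induction k with
  | zero =>
    have := phi_eq_orbitPt hα0 hα (by linarith) hh le_rfl
    rw [phi] at this ⊢
    rw [Function.iterate_succ_apply', Nat.add_zero, this, f_orbitPt_two_mul hα0 hα hl]
  | succ k ih =>
    have := ih (by omega)
    rw [phi] at this ⊢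
    rw [Function.iterate_succ_apply', ← Nat.add_assoc, this,
      f_orbitPt hα0 hα (by linarith) hh (by omega)]
    rfl

end OrbitPt

/-- Iterating `x ↦ 1 / (λ - x)` from `1 / (λ + R)`, with `λ = 2 cos θ`. -/
lemma height_even_eq {h : ℕ} {θ R : ℝ} {L : ℕ → ℝ} (hR : 0 < R)
    (hs : ∀ k : ℕ, k ≤ h → 0 < Real.sin ((k + 1 : ℕ) * θ))
    (hL2 : L 2 = 1 / (2 * Real.cos θ + R))
    (hLj : ∀ j : ℕ, 3 ≤ j → j ≤ 2 * h + 1 → L j = 1 / (2 * Real.cos θ - L (j - 2)))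
    {k : ℕ} (hk : k + 1 ≤ h) :
    L (2 * (k + 1)) = (Real.sin ((k + 1 : ℕ) * θ) + Real.sin (k * θ) * R) /
      (Real.sin ((k + 2 : ℕ) * θ) + Real.sin ((k + 1 : ℕ) * θ) * R) := by
  induction k with
  | zero =>
    have := hs 0 (by omega)
    simp only [zero_add, Nat.cast_one, one_mul, Nat.cast_zero, zero_mul, Real.sin_zero, add_zero,
      Nat.cast_ofNat, mul_one] at this ⊢
    rw [hL2, Real.sin_two_mul]
    rw [show 2 * Real.sin θ * Real.cos θ + Real.sin θ * R
      = Real.sin θ * (2 * Real.cos θ + R) by ring]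
    rw [← div_div, div_self this.ne']
  | succ k ih =>
    have h1 := ih (by omega)
    have p1 := hs k (by omega)
    have p2 := hs (k + 1) (by omega)
    rw [hLj _ (by omega) (by omega), show 2 * (k + 1 + 1) - 2 = 2 * (k + 1) by omega, h1]
    have r1 : Real.sin ((k + 1 + 2 : ℕ) * θ) =
        2 * Real.cos θ * Real.sin ((k + 2 : ℕ) * θ) - Real.sin ((k + 1 : ℕ) * θ) := by
      have a1 : ((k + 1 + 2 : ℕ) : ℝ) * θ = (k + 2 : ℕ) * θ + θ := by push_cast; ring
      have a2 : ((k + 1 : ℕ) : ℝ) * θ = (k + 2 : ℕ) * θ - θ := by push_cast; ring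
      rw [a1, a2, Real.sin_add, Real.sin_sub]; ring
    have r2 : Real.sin (k * θ) =
        2 * Real.cos θ * Real.sin ((k + 1 : ℕ) * θ) - Real.sin ((k + 2 : ℕ) * θ) := by
      have a1 : ((k + 2 : ℕ) : ℝ) * θ = (k + 1 : ℕ) * θ + θ := by push_cast; ring
      have a2 : (k : ℝ) * θ = (k + 1 : ℕ) * θ - θ := by push_cast; ring
      rw [a1, a2, Real.sin_add, Real.sin_sub]; ring
    have p3 : 0 < Real.sin ((k + 2 : ℕ) * θ) := p2
    rw [show ((k + 1 + 1 : ℕ) : ℝ) = ((k + 2 : ℕ) : ℝ) from rfl, r1, r2]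
    have p4 : Real.sin ((k + 2 : ℕ) * θ) + Real.sin ((k + 1 : ℕ) * θ) * R ≠ 0 := by positivity
    rw [sub_div' p4, one_div_div]
    congr 1
    ring

lemma height_two_mul {h : ℕ} {θ R : ℝ} {L : ℕ → ℝ} (hh : 1 ≤ h) (hθ : (2 * h + 3) * θ = π)
    (hR0 : 0 < R) (hR : R ^ 2 + (2 - 2 * Real.cos θ) * R = 1)
    (hL2 : L 2 = 1 / (2 * Real.cos θ + R))
    (hLj : ∀ j : ℕ, 3 ≤ j → j ≤ 2 * h + 1 → L j = 1 / (2 * Real.cos θ - L (j - 2))) :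
    L (2 * h) = 2 * Real.cos θ - 1 / R := by
  have hθ0 : 0 < θ := by
    by_contra hc
    have : (0 : ℝ) ≤ 2 * h + 3 := by positivity
    nlinarith [Real.pi_pos]
  have hs : ∀ k : ℕ, k ≤ h → 0 < Real.sin ((k + 1 : ℕ) * θ) := fun k hk => by
    have hk' : (k : ℝ) ≤ h := by exact_mod_cast hk
    have : (0 : ℝ) ≤ h := by positivity
    apply Real.sin_pos_of_pos_of_lt_pi (by positivity)
    rw [← hθ]; push_cast; nlinarith
  obtain ⟨k, rfl⟩ : ∃ k, h = k + 1 := ⟨h - 1, by omega⟩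
  rw [height_even_eq hR0 hs hL2 hLj le_rfl]
  have p1 := hs k (by omega)
  have p2 := hs (k + 1) (by omega)
  have a0 : Real.sin ((k + 3 : ℕ) * θ) = Real.sin ((k + 2 : ℕ) * θ) := by
    rw [← Real.sin_pi_sub, ← hθ]; congr 1; push_cast; ring
  have r1 : Real.sin ((k + 1 : ℕ) * θ) =
      2 * Real.cos θ * Real.sin ((k + 2 : ℕ) * θ) - Real.sin ((k + 2 : ℕ) * θ) := by
    nth_rewrite 2 [← a0]
    have a1 : ((k + 3 : ℕ) : ℝ) * θ = (k + 2 : ℕ) * θ + θ := by push_cast; ring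
    have a2 : ((k + 1 : ℕ) : ℝ) * θ = (k + 2 : ℕ) * θ - θ := by push_cast; ring
    rw [a1, a2, Real.sin_add, Real.sin_sub]; ring
  have r2 : Real.sin (k * θ) =
      2 * Real.cos θ * Real.sin ((k + 1 : ℕ) * θ) - Real.sin ((k + 2 : ℕ) * θ) := by
    have a1 : ((k + 2 : ℕ) : ℝ) * θ = (k + 1 : ℕ) * θ + θ := by push_cast; ring
    have a2 : (k : ℝ) * θ = (k + 1 : ℕ) * θ - θ := by push_cast; ring
    rw [a1, a2, Real.sin_add, Real.sin_sub]; ring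
  have p3 : 0 < Real.sin ((k + 2 : ℕ) * θ) := p2
  have p4 : 0 < Real.sin ((k + 2 : ℕ) * θ) + Real.sin ((k + 1 : ℕ) * θ) * R := by positivity
  rw [div_eq_iff p4.ne', r2, r1]
  field_simp
  linear_combination (-1 : ℝ) * hR

/-- If `D` is the union of connected sets that are contained in pairwise disjoint open sets, then
these sets are the connected components of `D`. -/
lemma ncard_connectedComponentIn_iUnion {X ι : Type*} [TopologicalSpace X] {A U : ι → Set X}
    (hA : ∀ i, IsConnected (A i)) (hU : ∀ i, IsOpen (U i)) (hAU : ∀ i, A i ⊆ U i)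
    (hd : Pairwise (Function.onFun Disjoint U)) :
    {C : Set X | ∃ z ∈ ⋃ i, A i, C = connectedComponentIn (⋃ i, A i) z}.ncard = Nat.card ι := by
  have hcomp : ∀ i, ∀ z ∈ A i, connectedComponentIn (⋃ i, A i) z = A i := fun i z hz => by
    have hzD : z ∈ ⋃ i, A i := Set.mem_iUnion_of_mem i hz
    refine subset_antisymm (fun w hw => ?_)
      ((hA i).isPreconnected.subset_connectedComponentIn hz (Set.subset_iUnion A i))
    obtain ⟨j, hj⟩ := Set.mem_iUnion.1 (connectedComponentIn_subset _ _ hw)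
    have hsub : connectedComponentIn (⋃ i, A i) z ⊆ U i :=
      isPreconnected_connectedComponentIn.subset_left_of_subset_union (hU i)
        (isOpen_biUnion fun j (_ : j ≠ i) => hU j)
        (Set.disjoint_iUnion₂_right.2 fun j hji => hd (Ne.symm hji))
        (fun x hx => by
          obtain ⟨k, hk⟩ := Set.mem_iUnion.1 (connectedComponentIn_subset _ _ hx)
          by_cases hki : k = i
          · exact Or.inl (hki ▸ hAU k hk)
          · exact Or.inr (Set.mem_biUnion hki (hAU k hk)))
        ⟨z, mem_connectedComponentIn hzD, hAU i hz⟩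
    by_cases hji : j = i
    · exact hji ▸ hj
    · exact absurd (hsub hw) (Set.disjoint_left.1 (hd hji) (hAU j hj))
  have hset : {C : Set X | ∃ z ∈ ⋃ i, A i, C = connectedComponentIn (⋃ i, A i) z} =
      Set.range A := by
    ext C
    constructor
    · rintro ⟨z, hz, rfl⟩
      obtain ⟨i, hi⟩ := Set.mem_iUnion.1 hz
      exact ⟨i, (hcomp i z hi).symm⟩
    · rintro ⟨i, rfl⟩
      obtain ⟨z, hz⟩ := (hA i).nonempty
      exact ⟨z, Set.mem_iUnion_of_mem i hz, (hcomp i z hz).symm⟩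
  have hinj : Function.Injective A := fun i j hij => by
    by_contra hne
    obtain ⟨z, hz⟩ := (hA i).nonempty
    exact Set.disjoint_left.1 (hd hne) (hAU i hz) (hAU j (hij ▸ hz))
  rw [hset, ← Set.image_univ, Set.ncard_image_of_injective _ hinj, Set.ncard_univ]

lemma joinedIn_vertical {A : Set (ℝ × ℝ)} {t v w : ℝ} (hvw : v ≤ w)
    (hA : ∀ s ∈ Set.Icc v w, (t, s) ∈ A) : JoinedIn A (t, v) (t, w) := by
  apply JoinedIn.of_segment_subset
  rw [← Prod.image_mk_segment_right, segment_eq_Icc hvw]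
  rintro _ ⟨s, hs, rfl⟩
  exact hA s hs

lemma joinedIn_horizontal {A : Set (ℝ × ℝ)} {t s v : ℝ} (hts : t ≤ s)
    (hA : ∀ r ∈ Set.Icc t s, (r, v) ∈ A) : JoinedIn A (t, v) (s, v) := by
  apply JoinedIn.of_segment_subset
  rw [← Prod.image_mk_segment_left, segment_eq_Icc hts]
  rintro _ ⟨r, hr, rfl⟩
  exact hA r hr

/-- The part of `D` over `[a, b)`, where `Ω` has height `y`, in terms of `K = 1 / H`. -/
def strip (K a b y : ℝ) : Set (ℝ × ℝ) :=
  {z | a ≤ z.1 ∧ z.1 < b ∧ 0 ≤ z.2 ∧ z.2 ≤ y ∧ 1 < z.2 * (K - z.1) ∧ 1 < -z.1 * (K + z.2)}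

lemma strip_up {K a b y t v w : ℝ} (hK : 0 < K) (hb : b ≤ 0) (hz : (t, v) ∈ strip K a b y)
    (hvw : v ≤ w) (hw : w ≤ y) : (t, w) ∈ strip K a b y := by
  obtain ⟨h1, h2, h3, h4, h5, h6⟩ := hz
  simp only at h1 h2 h3 h4 h5 h6
  exact ⟨h1, h2, h3.trans hvw, hw, by simp only; nlinarith, by simp only; nlinarith⟩

lemma strip_left {K a b y t s v : ℝ} (hK : 0 < K) (hz : (t, v) ∈ strip K a b y)
    (has : a ≤ s) (hst : s ≤ t) : (s, v) ∈ strip K a b y := by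
  obtain ⟨h1, h2, h3, h4, h5, h6⟩ := hz
  simp only at h1 h2 h3 h4 h5 h6
  exact ⟨has, hst.trans_lt h2, h3, h4, by simp only; nlinarith, by simp only; nlinarith⟩

lemma strip_joinedIn {K a b y t v : ℝ} (hK : 0 < K) (hb : b ≤ 0) (hz : (t, v) ∈ strip K a b y) :
    JoinedIn (strip K a b y) (a, y) (t, v) := by
  have htop : (t, y) ∈ strip K a b y := strip_up hK hb hz hz.2.2.2.1 le_rfl
  exact (joinedIn_horizontal hz.1 fun r hr => strip_left hK htop hr.1 hr.2).trans
    (joinedIn_vertical hz.2.2.2.1 fun s hs => strip_up hK hb hz hs.1 hs.2).symm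

lemma isConnected_strip {K a b y : ℝ} (hK : 0 < K) (hb : b ≤ 0) (hz : (a, y) ∈ strip K a b y) :
    IsConnected (strip K a b y) :=
  IsPathConnected.isConnected ⟨_, hz, fun _ hw => strip_joinedIn hK hb hw⟩

lemma strip_fst_lt {K a b y : ℝ} {z : ℝ × ℝ} (hK : 0 < K) (hb : b ≤ 0) (hy : 0 < y)
    (hz : z ∈ strip K a b y) : z.1 < K - 1 / y ∧ z.1 < -(1 / (K + y)) := by
  obtain ⟨-, h2, -, h4, h5, h6⟩ := hz
  constructor
  · have h7 : 1 < (K - z.1) * y := by nlinarith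
    rw [lt_sub_comm, div_lt_iff₀ hy]
    exact h7
  · have h7 : 1 < -z.1 * (K + y) := by nlinarith
    rw [lt_neg, div_lt_iff₀ (by linarith)]
    exact h7

lemma exists_mem_Ico_of_seq {e : ℕ → ℝ} {m n : ℕ} {t : ℝ} (hmn : m ≤ n) (h1 : e m ≤ t)
    (h2 : t < e n) : ∃ j, m < j ∧ j ≤ n ∧ e (j - 1) ≤ t ∧ t < e j := by
  induction n, hmn using Nat.le_induction with
  | base => exact absurd h2 h1.not_gt
  | succ n hmn ih =>
    by_cases ht : t < e n
    · obtain ⟨j, hj1, hj2, hj3⟩ := ih ht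
      exact ⟨j, hj1, by omega, hj3⟩
    · exact ⟨n + 1, by omega, le_rfl, not_lt.1 ht, h2⟩

/-- The strips between the points `2 / λ - λ` and `-1 / (λ + 1)` form a connected set. -/
lemma isConnected_middle {h : ℕ} (hh : 2 ≤ h) {l K : ℝ} {e L : ℕ → ℝ}
    (hl : 1 < l) (hl2 : l < 2) (hK : 2 ≤ K)
    (hmono : ∀ i j, i ≤ j → j ≤ 2 * h + 1 → e i ≤ e j)
    (he3 : e (2 * h - 1) = -1 / l) (he4 : e (2 * h) = -1 / (1 + l))
    (hLj : ∀ j, 3 ≤ j → j ≤ 2 * h + 1 → 1 / l < L j) :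
    IsConnected (⋃ j ∈ Finset.Icc 3 (2 * h), strip K (e (j - 1)) (e j) (L j)) := by
  set A := ⋃ j ∈ Finset.Icc 3 (2 * h), strip K (e (j - 1)) (e j) (L j)
  have hl0 : 0 < l := by linarith
  have hle : (1 : ℝ) / 2 < 1 / l := one_div_lt_one_div_of_lt hl0 hl2
  have e34 : e (2 * h - 1) < e (2 * h) := by
    rw [he3, he4, neg_div, neg_div, neg_lt_neg_iff]
    exact one_div_lt_one_div_of_lt hl0 (by linarith)
  have he4' : e (2 * h) ≤ 0 := by
    rw [he4, neg_div, neg_nonpos]; positivity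
  have hsub : ∀ j, 3 ≤ j → j ≤ 2 * h → strip K (e (j - 1)) (e j) (L j) ⊆ A := fun j h1 h2 =>
    Set.subset_biUnion_of_mem (u := fun j => strip K (e (j - 1)) (e j) (L j))
      (show j ∈ Finset.Icc 3 (2 * h) from Finset.mem_Icc.2 ⟨h1, h2⟩)
  have half_mem : ∀ j, 3 ≤ j → j ≤ 2 * h → ∀ t, e (j - 1) ≤ t → t < e j → t ≤ -1 / l →
      (t, (1 : ℝ) / 2) ∈ strip K (e (j - 1)) (e j) (L j) := fun j h1 h2 t h3 h4 h5 => by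
    have := hLj j h1 (by omega)
    rw [neg_div] at h5
    refine ⟨h3, h4, by norm_num, by simp only; linarith, by simp only; linarith, ?_⟩
    simp only
    nlinarith
  have base_mem := half_mem (2 * h) (by omega) le_rfl (-1 / l) he3.le (he3 ▸ e34) le_rfl
  have half_joined : ∀ t, e 2 ≤ t → t ≤ -1 / l →
      JoinedIn A (t, (1 : ℝ) / 2) (-1 / l, 1 / 2) := fun t h1 h2 => by
    refine joinedIn_horizontal h2 fun r hr => ?_
    obtain ⟨j, hj1, hj2, hj3, hj4⟩ := exists_mem_Ico_of_seq (e := e) (m := 2) (n := 2 * h)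
      (by omega) (h1.trans hr.1) (hr.2.trans_lt (he3 ▸ e34))
    exact hsub j hj1 hj2 (half_mem j hj1 hj2 r hj3 hj4 hr.2)
  have left_joined : ∀ j, 3 ≤ j → j ≤ 2 * h → ∀ t v, (t, v) ∈ strip K (e (j - 1)) (e j) (L j) →
      t ≤ -1 / l → JoinedIn A (t, v) (-1 / l, 1 / 2) := fun j h1 h2 t v hz ht => by
    have hej : e j ≤ 0 := (hmono j (2 * h) h2 (by omega)).trans he4'
    have hm := half_mem j h1 h2 t hz.1 hz.2.1 ht
    refine JoinedIn.trans ?_ (half_joined t ((hmono 2 (j - 1) (by omega) (by omega)).trans hz.1) ht)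
    rcases le_total v (1 / 2) with hv | hv
    · exact joinedIn_vertical hv fun s hs =>
        hsub j h1 h2 (strip_up (by linarith) hej hz hs.1 (hs.2.trans hm.2.2.2.1))
    · exact (joinedIn_vertical hv fun s hs =>
        hsub j h1 h2 (strip_up (by linarith) hej hm hs.1 (hs.2.trans hz.2.2.2.1))).symm
  refine IsPathConnected.isConnected ⟨(-1 / l, 1 / 2), hsub _ (by omega) le_rfl base_mem, ?_⟩
  rintro ⟨t, v⟩ hz
  obtain ⟨j, hj, hz⟩ := Set.mem_iUnion₂.1 hz
  obtain ⟨hj1, hj2⟩ := Finset.mem_Icc.1 hj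
  rcases le_total t (-1 / l) with ht | ht
  · exact (left_joined j hj1 hj2 t v hz ht).symm
  · obtain rfl : j = 2 * h := by
      by_contra hne
      have h1 := hmono j (2 * h - 1) (by omega) (by omega)
      have h2 : t < e j := hz.2.1
      linarith
    have h1 := (strip_joinedIn (by linarith) he4' hz).mono (hsub _ hj1 hj2)
    refine JoinedIn.trans (JoinedIn.symm ?_) h1
    have h2 : (e (2 * h - 1), L (2 * h)) ∈ strip K (e (2 * h - 1)) (e (2 * h)) (L (2 * h)) :=
      (strip_joinedIn (by linarith) he4' hz).source_mem
    exact left_joined _ hj1 hj2 _ _ h2 he3.le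

lemma ncard_components_strips {h : ℕ} (hh : 2 ≤ h) {l R K : ℝ} {e L : ℕ → ℝ}
    (hl : 3 / 2 < l) (hl2 : l < 2) (hR : l / 2 < R) (hR1 : R < 1) (hK : K = R + 1 / R)
    (hmono : ∀ i j, i ≤ j → j ≤ 2 * h + 1 → e i ≤ e j)
    (he0 : e 0 = -(l / 2)) (he1 : e 1 = 1 - l) (he2 : e 2 = 2 / l - l)
    (he3 : e (2 * h - 1) = -1 / l) (he4 : e (2 * h) = -1 / (1 + l)) (he5 : e (2 * h + 1) = 0)
    (hL1 : L 1 = 1 / (l + 1 / R)) (hL2 : L 2 = 1 / (l + R)) (hL3 : L (2 * h) = l - 1 / R)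
    (hL4 : L (2 * h + 1) = l - R) (hLj : ∀ j, 3 ≤ j → j ≤ 2 * h + 1 → 1 / l < L j)
    {D : Set (ℝ × ℝ)}
    (hD : D = ⋃ j ∈ Finset.Icc 1 (2 * h + 1), strip K (e (j - 1)) (e j) (L j)) :
    {C : Set (ℝ × ℝ) | ∃ z ∈ D, C = connectedComponentIn D z}.ncard = 4 := by
  have hl0 : 0 < l := by linarith
  have hR0 : 0 < R := by linarith
  have hRi : 1 < 1 / R := by rwa [lt_div_iff₀ hR0, one_mul]
  have hRl : 1 / R < 2 / l := by rw [div_lt_div_iff₀ hR0 hl0]; linarith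
  have hl1 : 1 < 2 / l := by rwa [lt_div_iff₀ hl0, one_mul]
  have hK2 : 2 ≤ K := by
    have : R * (1 / R) = 1 := mul_one_div_cancel hR0.ne'
    rw [hK]; nlinarith
  have hK0 : 0 < K := by linarith
  have hlj : (1 : ℝ) / 2 < 1 / l := one_div_lt_one_div_of_lt hl0 hl2
  have hl1i : 0 < 1 / (1 + l) := by positivity
  have e12 : e 1 < e 2 := by rw [he1, he2]; linarith
  have hneg : ∀ i ≤ 2 * h + 1, e i ≤ 0 := fun i hi => he5 ▸ hmono i _ hi le_rfl
  let A : Fin 4 → Set (ℝ × ℝ) := ![strip K (e 0) (e 1) (L 1), strip K (e 1) (e 2) (L 2),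
    ⋃ j ∈ Finset.Icc 3 (2 * h), strip K (e (j - 1)) (e j) (L j),
    strip K (e (2 * h)) (e (2 * h + 1)) (L (2 * h + 1))]
  let U : Fin 4 → Set (ℝ × ℝ) := ![{z | z.1 < R - l}, {z | R - l < z.1 ∧ z.1 < 1 / R - l},
    {z | 1 / R - l < z.1 ∧ z.1 < -(1 / (R + l))}, {z | -(1 / (R + l)) < z.1}]
  have hDA : D = ⋃ i, A i := by
    rw [hD]
    ext z
    simp only [Set.mem_iUnion, Finset.mem_Icc, Fin.exists_fin_succ, A, exists_prop]
    simp only [Matrix.cons_val_zero, Matrix.cons_val_succ, IsEmpty.exists_iff, or_false]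
    simp only [Set.mem_iUnion, exists_prop]
    constructor
    · rintro ⟨j, ⟨hj1, hj2⟩, hz⟩
      rcases (by omega : j = 1 ∨ j = 2 ∨ 3 ≤ j ∧ j ≤ 2 * h ∨ j = 2 * h + 1)
        with rfl | rfl | hj | rfl
      · exact Or.inl hz
      · exact Or.inr (Or.inl hz)
      · exact Or.inr (Or.inr (Or.inl ⟨j, hj, hz⟩))
      · exact Or.inr (Or.inr (Or.inr hz))
    · rintro (hz | hz | ⟨j, hj, hz⟩ | hz)
      · exact ⟨1, by omega, hz⟩
      · exact ⟨2, by omega, hz⟩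
      · exact ⟨j, by omega, hz⟩
      · exact ⟨2 * h + 1, by omega, hz⟩
  have hA : ∀ i, IsConnected (A i) := by
    have p0 : 0 < l + 1 / R := by positivity
    have p1 : 0 < l + R := by positivity
    intro i
    fin_cases i
    · refine isConnected_strip hK0 (hneg 1 (by omega)) ⟨le_rfl, ?_, ?_, le_rfl, ?_, ?_⟩ <;> simp only
      · rw [he0, he1]; linarith
      · rw [hL1]; positivity
      · rw [hL1, he0, one_div_mul_eq_div, one_lt_div p0, hK]; linarith
      · have : 0 < L 1 := by rw [hL1]; positivity
        rw [he0]; nlinarith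
    · refine isConnected_strip hK0 (hneg 2 (by omega)) ⟨le_rfl, e12, ?_, le_rfl, ?_, ?_⟩ <;>
        simp only
      · rw [hL2]; positivity
      · rw [hL2, he1, one_div_mul_eq_div, one_lt_div p1, hK]; linarith
      · have : 0 < L 2 := by rw [hL2]; positivity
        rw [he1]; nlinarith
    · exact isConnected_middle hh (by linarith) hl2 hK2 hmono he3 he4 hLj
    · refine isConnected_strip hK0 (hneg _ le_rfl) ⟨le_rfl, ?_, ?_, le_rfl, ?_, ?_⟩ <;> simp only
      · rw [he4, he5, neg_div]; linarith
      · rw [hL4]; linarith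
      · have h1 := hLj (2 * h + 1) (by omega) le_rfl
        rw [he4, neg_div]; nlinarith
      · rw [he4, hL4, neg_div, neg_neg, one_div_mul_eq_div, one_lt_div (by linarith), hK]; linarith
  have hU : ∀ i, IsOpen (U i) := by
    intro i
    fin_cases i
    · exact isOpen_lt continuous_fst continuous_const
    · exact (isOpen_lt continuous_const continuous_fst).inter
        (isOpen_lt continuous_fst continuous_const)
    · exact (isOpen_lt continuous_const continuous_fst).inter
        (isOpen_lt continuous_fst continuous_const)
    · exact isOpen_lt continuous_const continuous_fst
  have hRl1 : 1 / (1 + l) < 1 / (R + l) := one_div_lt_one_div_of_lt (by linarith) (by linarith)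
  have hRl2 : 1 / (R + l) < 1 / l := one_div_lt_one_div_of_lt (by linarith) (by linarith)
  have hAU : ∀ i, A i ⊆ U i := by
    have hp : 0 < R + l := by positivity
    intro i
    fin_cases i
    · intro z hz
      have h1 := (strip_fst_lt hK0 (hneg 1 (by omega)) (by rw [hL1]; positivity) hz).1
      rw [hL1, one_div_one_div, hK] at h1
      change z.1 < R - l
      linarith
    · intro z hz
      have h1 := (strip_fst_lt hK0 (hneg 2 (by omega)) (by rw [hL2]; positivity) hz).1
      have h2 : e 1 ≤ z.1 := hz.1
      rw [hL2, one_div_one_div, hK] at h1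
      change R - l < z.1 ∧ z.1 < 1 / R - l
      constructor <;> linarith
    · intro z hz
      obtain ⟨j, hj, hz⟩ := Set.mem_iUnion₂.1 hz
      obtain ⟨hj1, hj2⟩ := Finset.mem_Icc.1 hj
      change 1 / R - l < z.1 ∧ z.1 < -(1 / (R + l))
      have h1 : e (j - 1) ≤ z.1 := hz.1
      have h2 : z.1 < e j := hz.2.1
      constructor
      · have := hmono 2 (j - 1) (by omega) (by omega)
        linarith
      · rcases hj2.lt_or_eq with hlt | rfl
        · have := hmono j (2 * h - 1) (by omega) (by omega)
          rw [he3, neg_div] at this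
          linarith
        · have hpos := hLj (2 * h) hj1 (by omega)
          have h3 := (strip_fst_lt hK0 (hneg (2 * h) (by omega)) (by linarith) hz).2
          rwa [hL3, hK, show R + 1 / R + (l - 1 / R) = R + l by ring] at h3
    · intro z hz
      have h1 : e (2 * h) ≤ z.1 := hz.1
      rw [he4, neg_div] at h1
      change -(1 / (R + l)) < z.1
      linarith
  have hRc : 1 / R - l < -(1 / (R + l)) := by
    have h1 := hA 2
    obtain ⟨z, hz⟩ := h1.nonempty
    have := hAU 2 hz
    exact this.1.trans this.2
  have hd : Pairwise (Function.onFun Disjoint U) := by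
    intro i j hij
    refine Set.disjoint_left.2 fun z hi hj => ?_
    fin_cases i <;> fin_cases j <;>
      first
      | exact hij rfl
      | (simp [U, -one_div] at hi hj; linarith)
  rw [hDA, ncard_connectedComponentIn_iUnion hA hU hAU hd, Nat.card_fin]

lemma Rodd_sq (l : ℝ) : Rodd l ^ 2 + (2 - l) * Rodd l = 1 := by
  have h1 : Real.sqrt ((2 - l) ^ 2 + 4) ^ 2 = (2 - l) ^ 2 + 4 := Real.sq_sqrt (by positivity)
  rw [Rodd]
  linear_combination h1 / 4

lemma half_lt_Rodd {l : ℝ} (hl : l < 2) : l / 2 < Rodd l := by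
  have : 2 < Real.sqrt ((2 - l) ^ 2 + 4) := by
    apply Real.lt_sqrt_of_sq_lt
    nlinarith
  rw [Rodd]
  linarith

lemma Rodd_lt_one {l : ℝ} (hl : l < 2) : Rodd l < 1 := by
  have : Real.sqrt ((2 - l) ^ 2 + 4) < 4 - l := by
    rw [Real.sqrt_lt' (by linarith)]
    nlinarith
  rw [Rodd]
  linarith

lemma Hodd_eq {l : ℝ} (hR : 0 < Rodd l) : Hodd l = 1 / (Rodd l + 1 / Rodd l) := by
  have h1 : 1 / Rodd l = Rodd l + (2 - l) := by
    rw [div_eq_iff hR.ne']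
    linear_combination -Rodd_sq l
  have h2 : (2 - l) ^ 2 + 4 = 2 ^ 2 * ((1 - l / 2) ^ 2 + 1) := by ring
  rw [h1, Hodd]
  congr 1
  rw [Rodd, h2, Real.sqrt_mul (by positivity), Real.sqrt_sq (by norm_num)]
  ring

lemma one_div_lt_div_iff {K a b : ℝ} (hK : 0 < K) (hb : 0 < b) : 1 / K < a / b ↔ b < a * K := by
  rw [div_lt_div_iff₀ hK hb, one_mul]

/-- No point of the part of `Ω` over `t ≥ 0` belongs to `D`. -/
lemma not_lt_of_nonneg {R t v : ℝ} (hR : 0 < R) (hR1 : R < 1) (ht : 0 ≤ t) (htR : t ≤ R)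
    (hv : 0 ≤ v) (hvR : v ≤ R) :
    ¬ (1 / (R + 1 / R) < v / (1 + t * v) ∧ 1 / (R + 1 / R) < |t| / (1 + t * v)) := by
  have hK : 0 < R + 1 / R := by positivity
  have hb : 0 < 1 + t * v := by positivity
  have hR2 : 1 < 1 / R := by rwa [lt_div_iff₀ hR, one_mul]
  have key : ∀ x, x ≤ R → x * (R + 1 / R) ≤ 1 + x ^ 2 := fun x hx => by
    have h1 : R * (1 / R) = 1 := mul_one_div_cancel hR.ne'
    nlinarith [mul_nonneg (sub_nonneg.2 hx) (show 0 ≤ 1 / R - x by linarith)]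
  rw [one_div_lt_div_iff hK hb, one_div_lt_div_iff hK hb, abs_of_nonneg ht]
  rintro ⟨h1, h2⟩
  rcases le_total t v with h | h
  · nlinarith [key t htR]
  · nlinarith [key v hvR]

lemma theta_prev_iff {K t v : ℝ} (hK : 0 < K) (hb : 0 < 1 + t * v) :
    v / (1 + t * v) > 1 / K ↔ 1 < v * (K - t) := by
  rw [gt_iff_lt, one_div_lt_div_iff hK hb, mul_sub]
  constructor <;> intro <;> linarith

lemma theta_cur_iff {K t v : ℝ} (hK : 0 < K) (ht : t < 0) (hb : 0 < 1 + t * v) :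
    |t| / (1 + t * v) > 1 / K ↔ 1 < -t * (K + v) := by
  rw [gt_iff_lt, one_div_lt_div_iff hK hb, abs_of_neg ht, mul_add]
  constructor <;> intro <;> linarith

lemma lower_curve_iff {K t v : ℝ} (hK : 0 < K) (ht : t < 0) :
    v > 1 / K / (1 - 1 / K * t) ↔ 1 < v * (K - t) := by
  have : 1 / K / (1 - 1 / K * t) = 1 / (K - t) := by field_simp
  rw [gt_iff_lt, this, div_lt_iff₀ (by linarith)]

lemma upper_curve_iff {K t v : ℝ} (hK : 0 < K) (ht : t < 0) :
    v > (|t| - 1 / K) / (1 / K * t) ↔ 1 < -t * (K + v) := by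
  have h1 : (|t| - 1 / K) / (1 / K * t) = (-t * K - 1) / t := by
    have := ht.ne
    rw [abs_of_neg ht]
    field_simp
  rw [gt_iff_lt, h1, div_lt_iff_of_neg ht, mul_add]
  constructor <;> intro <;> linarith

lemma height_le_one {h : ℕ} {l : ℝ} {L : ℕ → ℝ} (hl : l ≤ 2)
    (hlt : ∀ j : ℕ, 1 ≤ j → j ≤ 2 * h + 1 → L j < l)
    (hLj : ∀ j : ℕ, 3 ≤ j → j ≤ 2 * h + 1 → L j = 1 / (l - L (j - 2)))
    (h0 : L (2 * h) ≤ 1) (h1 : L (2 * h + 1) ≤ 1) {j : ℕ} (hj1 : 1 ≤ j) (hj : j ≤ 2 * h + 1) :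
    L j ≤ 1 := by
  by_cases hlast : 2 * h ≤ j
  · rcases (by omega : j = 2 * h ∨ j = 2 * h + 1) with rfl | rfl
    exacts [h0, h1]
  · have h2 := height_le_one hl hlt hLj h0 h1 (j := j + 2) (by omega) (by omega)
    have h3 := hlt j hj1 hj
    rw [hLj (j + 2) (by omega) (by omega), Nat.add_sub_cancel, div_le_one (by linarith)] at h2
    linarith
termination_by 2 * h + 1 - j

lemma lam_gt {q : ℕ} (hq : 7 ≤ q) : 3 / 2 < lam q := by
  have hq' : (7 : ℝ) ≤ q := by exact_mod_cast hq
  have h1 : Real.cos (π / 6) ≤ Real.cos (π / q) := by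
    apply Real.cos_le_cos_of_nonneg_of_le_pi (by positivity)
    · linarith [Real.pi_pos]
    · gcongr
      linarith
  have h2 : 3 / 2 < Real.sqrt 3 := Real.lt_sqrt_of_sq_lt (by norm_num)
  rw [Real.cos_pi_div_six] at h1
  rw [lam]
  linarith

lemma lam_lt_two {q : ℕ} (hq : 1 ≤ q) : lam q < 2 := by
  have hq' : (1 : ℝ) ≤ q := by exact_mod_cast hq
  have h1 : Real.cos (π / q) < Real.cos 0 := by
    apply Real.cos_lt_cos_of_nonneg_of_le_pi le_rfl
    · exact div_le_self Real.pi_pos.le hq'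
    · positivity
  rw [Real.cos_zero] at h1
  rw [lam]
  linarith

/-- shape of `D` and its four connected components (odd case `q = 2h+3`, `h ≥ 2`). -/
theorem D_four_components_odd (q h : ℕ) (hh : 2 ≤ h) (hq : q = 2 * h + 3)
    (L : ℕ → ℝ)
    (hLmem : ∀ j : ℕ, 1 ≤ j → j ≤ 2 * h + 1 → L j ∈ Set.Ioo 0 (lam q))
    (hL1 : L 1 = 1 / (2 * lam q - L (2 * h)))
    (hL2 : L 2 = 1 / (2 * lam q - L (2 * h + 1)))
    (hLj : ∀ j : ℕ, 3 ≤ j → j ≤ 2 * h + 1 → L j = 1 / (lam q - L (j - 2)))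
    (hR : Rodd (lam q) = lam q - L (2 * h + 1))
    (Om D : Set (ℝ × ℝ))
    (hOm : Om =
      (⋃ m ∈ Finset.Icc 1 h,
          (Set.Ico (phi (lam q) (h + m)) (phi (lam q) m)) ×ˢ Set.Icc (0 : ℝ) (L (2 * m))) ∪
      (⋃ m ∈ Finset.Icc 0 h,
          (Set.Ico (phi (lam q) m) (phi (lam q) (h + m + 1))) ×ˢ
            Set.Icc (0 : ℝ) (L (2 * m + 1))) ∪
      (Set.Ico (0 : ℝ) (lam q / 2)) ×ˢ Set.Icc (0 : ℝ) (Rodd (lam q)))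
    (hD : D =
      {z ∈ Om | z.2 / (1 + z.1 * z.2) > Hodd (lam q) ∧ |z.1| / (1 + z.1 * z.2) > Hodd (lam q)}) :
    D = {z ∈ Om | z.1 < 0 ∧ z.2 > Hodd (lam q) / (1 - Hodd (lam q) * z.1) ∧
          z.2 > (|z.1| - Hodd (lam q)) / (Hodd (lam q) * z.1)} ∧
    {C : Set (ℝ × ℝ) | ∃ z ∈ D, C = connectedComponentIn D z}.ncard = 4 := by
  have hl : 3 / 2 < lam q := lam_gt (by omega)
  have hl2 : lam q < 2 := lam_lt_two (by omega)
  have hRl := half_lt_Rodd hl2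
  have hR1 := Rodd_lt_one hl2
  have hR0 : 0 < Rodd (lam q) := by linarith
  have hRsq := Rodd_sq (lam q)
  have hHK := Hodd_eq hR0
  have hRi : 1 < 1 / Rodd (lam q) := by rwa [lt_div_iff₀ hR0, one_mul]
  have hK0 : 0 < Rodd (lam q) + 1 / Rodd (lam q) := by positivity
  have hq0 : (0 : ℝ) < q := by rw [hq]; positivity
  have hqr : (q : ℝ) = 2 * h + 3 := by rw [hq]; push_cast; ring
  obtain ⟨α, hα⟩ : ∃ α : ℝ, α = π / q / 2 := ⟨_, rfl⟩
  have hα0 : 0 < α := by rw [hα]; positivity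
  have hαh : (2 * h + 3) * α = π / 2 := by rw [hα, ← hqr]; field_simp
  have hlα : lam q = 2 * Real.cos (2 * α) := by rw [lam, hα]; congr 2; ring
  have hL2h : L (2 * h) = lam q - 1 / Rodd (lam q) := by
    rw [hlα] at hRsq hL2 hR hLj hR0 ⊢
    exact height_two_mul (by omega) (by linarith) hR0 hRsq (by rw [hL2, hR]; ring_nf) hLj
  have hLle : ∀ j, 1 ≤ j → j ≤ 2 * h + 1 → L j ≤ 1 := fun j h1 h2 =>
    height_le_one hl2.le (fun j h1 h2 => (hLmem j h1 h2).2) hLj (by linarith) (by linarith) h1 h2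
  have hmono : ∀ i j, i ≤ j → j ≤ 2 * h + 1 → orbitPt α i ≤ orbitPt α j :=
    fun i j => orbitPt_mono hα0 hαh
  have he0 : orbitPt α 0 = -(lam q / 2) := by rw [orbitPt_zero, hlα]
  have he5 := orbitPt_last hαh
  have hOm' : ∀ z, z ∈ Om ↔ (∃ j, (1 ≤ j ∧ j ≤ 2 * h + 1) ∧
      (orbitPt α (j - 1) ≤ z.1 ∧ z.1 < orbitPt α j) ∧ 0 ≤ z.2 ∧ z.2 ≤ L j) ∨
      ((0 ≤ z.1 ∧ z.1 < lam q / 2) ∧ 0 ≤ z.2 ∧ z.2 ≤ Rodd (lam q)) := by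
    have hphi : ∀ m ≤ h, phi (lam q) m = orbitPt α (2 * m) := fun m hm => by
      rw [hlα]; exact phi_eq_orbitPt hα0 hαh (by linarith) (by omega) hm
    have hphi' : ∀ m ≤ h, phi (lam q) (h + m + 1) = orbitPt α (2 * m + 1) := fun m hm => by
      rw [hlα]; exact phi_add_eq_orbitPt hα0 hαh (by linarith) (by omega) hm
    intro z
    simp only [hOm, Set.mem_union, Set.mem_iUnion, Finset.mem_Icc, Set.mem_prod, Set.mem_Ico,
      Set.mem_Icc, exists_prop]
    refine or_congr_left ⟨?_, ?_⟩
    · rintro (⟨m, hm, hz1, hz2⟩ | ⟨m, hm, hz1, hz2⟩)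
      · rw [show h + m = h + (m - 1) + 1 by omega, hphi' _ (by omega), hphi _ hm.2,
          show 2 * (m - 1) + 1 = 2 * m - 1 by omega] at hz1
        exact ⟨2 * m, by omega, hz1, hz2⟩
      · rw [hphi _ hm.2, hphi' _ hm.2] at hz1
        exact ⟨2 * m + 1, by omega, hz1, hz2⟩
    · rintro ⟨j, hj, hz1, hz2⟩
      obtain ⟨m, rfl | rfl⟩ := j.even_or_odd'
      · refine Or.inl ⟨m, by omega, ?_, hz2⟩
        rw [show h + m = h + (m - 1) + 1 by omega, hphi' _ (by omega), hphi _ (by omega),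
          show 2 * (m - 1) + 1 = 2 * m - 1 by omega]
        exact hz1
      · refine Or.inr ⟨m, by omega, ?_, hz2⟩
        rw [hphi _ (by omega), hphi' _ (by omega)]
        exact hz1
  have hneg : ∀ z ∈ Om, z.1 < 0 → 0 < 1 + z.1 * z.2 := fun z hz ht => by
    rcases (hOm' z).1 hz with ⟨j, ⟨h1, h2⟩, ⟨h3, -⟩, h4, h5⟩ | hz
    · have h6 := hLle j h1 h2
      have h7 := hmono 0 (j - 1) (by omega) (by omega)
      have h8 : -1 < z.1 := by linarith
      nlinarith
    · linarith [hz.1.1]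
  have hDneg : ∀ z ∈ D, z.1 < 0 := fun z hz => by
    rw [hD, hHK] at hz
    by_contra! ht
    rcases (hOm' z).1 hz.1 with ⟨j, ⟨h1, h2⟩, ⟨-, h3⟩, -⟩ | ⟨⟨-, h1⟩, h2, h3⟩
    · linarith [hmono j _ h2 le_rfl]
    · exact not_lt_of_nonneg hR0 hR1 ht (by linarith) h2 h3 hz.2
  have hDmem : ∀ z, z ∈ D ↔ z ∈ Om ∧ z.1 < 0 ∧
      1 < z.2 * (Rodd (lam q) + 1 / Rodd (lam q) - z.1) ∧
      1 < -z.1 * (Rodd (lam q) + 1 / Rodd (lam q) + z.2) := fun z => by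
    constructor
    · intro hz
      have ht := hDneg z hz
      rw [hD, hHK] at hz
      have hb := hneg z hz.1 ht
      exact ⟨hz.1, ht, (theta_prev_iff hK0 hb).1 hz.2.1, (theta_cur_iff hK0 ht hb).1 hz.2.2⟩
    · rintro ⟨hz, ht, h1, h2⟩
      have hb := hneg z hz ht
      rw [hD, hHK]
      exact ⟨hz, (theta_prev_iff hK0 hb).2 h1, (theta_cur_iff hK0 ht hb).2 h2⟩
  refine ⟨?_, ?_⟩
  · ext z
    rw [hDmem, hHK]
    refine and_congr_right fun _ => and_congr_right fun ht => ?_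
    rw [lower_curve_iff hK0 ht, upper_curve_iff hK0 ht]
  · refine ncard_components_strips hh hl hl2 hRl hR1 rfl hmono he0
      (by rw [orbitPt_one hα0 hαh, hlα]) ?_
      (by rw [orbitPt_two_mul_sub_one hα0 hαh (by omega), hlα])
      (by rw [orbitPt_two_mul hα0 hαh, hlα]) he5
      (by rw [hL1, hL2h]; ring_nf) (by rw [hL2, hR]; ring_nf) hL2h (by linarith) ?_ ?_
    · have h1 := orbitPt_add_two hα0 hαh (i := 0) (by omega)
      rw [zero_add, he0, ← hlα] at h1
      rw [h1]
      field_simp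
    · intro j h1 h2
      have h3 := hLmem (j - 2) (by omega) (by omega)
      rw [hLj j h1 h2]
      exact one_div_lt_one_div_of_lt (by linarith [h3.2]) (by linarith [h3.1])
    · ext z
      simp only [hDmem, hOm', Set.mem_iUnion, Finset.mem_Icc, exists_prop, strip, Set.mem_ofPred_eq]
      constructor
      · rintro ⟨⟨j, hj, ⟨h1, h2⟩, h3, h4⟩ | h1, h5, h6, h7⟩
        · exact ⟨j, hj, h1, h2, h3, h4, h6, h7⟩
        · linarith [h1.1.1]
      · rintro ⟨j, hj, h1, h2, h3, h4, h5, h6⟩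
        exact ⟨Or.inl ⟨j, hj, ⟨h1, h2⟩, h3, h4⟩,
          h2.trans_le (he5 ▸ hmono j _ hj.2 le_rfl), h5, h6⟩

end RosenTong
end
end

section
/- Fix an even integer q = 2p with p ≥ 3 and let λ = 2·cos(π/q). For every (t,v) ∈ ℝ² with −2/(3λ) ≤ t ≤ −1/(λ+1) and −2 − 1/t < v ≤ λ−1, one has (1 + 2tλ)(v − 2λ)/(1 + tv) > v/(1 + tv) > −t/(1 + tv) > 1/2. (For a G_q-irrational x with (t_n, v_n) in this region A, these three quantities are Θ_{n+1}, Θ_{n−1} and Θ_n respectively; in particular Θ_{n+1} > Θ_{n−1} > Θ_n > 1/2 on A.) -/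
noncomputable section

open Real Filter Topology MeasureTheory
open scoped Classical

namespace RosenTong

/-- `λ_q ≥ √3` for `q ≥ 6`. -/
lemma sqrt_three_le_lam {q : ℕ} (hq : 6 ≤ q) : √3 ≤ lam q := by
  have hq' : (6 : ℝ) ≤ q := by exact_mod_cast hq
  have hle : Real.pi / q ≤ Real.pi / 6 := by gcongr
  have hcos : Real.cos (Real.pi / 6) ≤ Real.cos (Real.pi / q) :=
    Real.cos_le_cos_of_nonneg_of_le_pi (by positivity) (by linarith [Real.pi_pos]) hle
  rw [Real.cos_pi_div_six] at hcos
  unfold lam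
  linarith

/-- on region `A` one has `Θ_{n+1} > Θ_{n-1} > Θ_n > 1/2` (even case). -/
theorem thetas_on_A_even (q p : ℕ) (hp : 3 ≤ p) (hq : q = 2 * p) (t v : ℝ)
    (ht1 : -2 / (3 * lam q) ≤ t) (ht2 : t ≤ -1 / (lam q + 1))
    (hv1 : -2 - 1 / t < v) (hv2 : v ≤ lam q - 1) :
    (1 + 2 * t * lam q) * (v - 2 * lam q) / (1 + t * v) > v / (1 + t * v) ∧
    v / (1 + t * v) > -t / (1 + t * v) ∧
    -t / (1 + t * v) > 1 / 2 := by
  have hl3 : √3 ≤ lam q := sqrt_three_le_lam (by omega)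
  generalize lam q = l at *
  have hl : 17 / 10 < l := (Real.lt_sqrt (by norm_num)).2 (by norm_num) |>.trans_le hl3
  obtain ⟨s, rfl⟩ : ∃ s, t = -s := ⟨-t, (neg_neg t).symm⟩
  have hs1 : 3 * l * s ≤ 2 := by
    rw [div_le_iff₀ (by positivity)] at ht1
    linarith
  have hs2 : 1 ≤ s * (l + 1) := by
    rw [le_div_iff₀ (by positivity)] at ht2
    linarith
  have hs : 0 < s := pos_of_mul_pos_left (by linarith) (by positivity : 0 ≤ l + 1)
  have hs_le : s < 2 / 5 := by nlinarith
  have hsv : 1 - 2 * s < s * v := by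
    have h := mul_lt_mul_of_pos_left hv1 hs
    have h' : s * (-2 - 1 / -s) = 1 - 2 * s := by
      field_simp
      ring
    linarith
  have hsv_le : s * v ≤ s * (l - 1) := mul_le_mul_of_nonneg_left hv2 hs.le
  have hden : 0 < 1 + -s * v := by linarith
  refine ⟨?_, ?_, ?_⟩
  · refine div_lt_div_of_pos_right ?_ hden
    have h : 0 < 2 * l * (s * (2 * l - v) - 1) := mul_pos (by positivity) (by linarith)
    linarith
  · refine div_lt_div_of_pos_right ?_ hden
    nlinarith
  · rw [gt_iff_lt, lt_div_iff₀ hden]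
    linarith

end RosenTong
end
end

section
/- Fix an even integer q = 2p with p ≥ 2 and let λ = 2·cos(π/q). For every (t,v) ∈ D with −1/λ ≤ t < −2/(3λ), one has (1 + tλ)(λ − v)/(1 + tv) < 1/2. (For a G_q-irrational x with (t_n, v_n) in this region B one has r_{n+1} = 1, ε_{n+1} = −1, ε_{n+2} = 1 and Θ_{n+1} = (1 + t_nλ)(λ − v_n)/(1 + t_nv_n), so Θ_{n+1} < 1/2 on B.) -/
noncomputable section

open Real Filter Topology MeasureTheory
open scoped Classical

namespace RosenTong

/-- With `t = -s` and `u = 1 + tl`, one has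
`s² (1 + tv - 2u(l - v)) = (1 + tv)(s - u)² + (2s - (1 + tv))u²`. -/
theorem future_coefficient_lt_half {l t v : ℝ} (hl : 0 < l) (hl2 : l ≤ 2)
    (ht : t < -2 / (3 * l)) (h : 1 / 2 < |t| / (1 + t * v)) :
    (1 + t * l) * (l - v) / (1 + t * v) < 1 / 2 := by
  have hpos : 0 < 1 + t * v := by
    by_contra hc
    linarith [div_nonpos_of_nonneg_of_nonpos (abs_nonneg t) (not_lt.mp hc)]
  have ht3 : t * (3 * l) < -2 := (lt_div_iff₀ (by positivity)).mp ht
  have ht0 : t < 0 := by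
    by_contra hc
    linarith [mul_nonneg (not_lt.mp hc) (by positivity : 0 ≤ 3 * l)]
  rw [abs_of_neg ht0, lt_div_iff₀ hpos] at h
  have hne : -t - (1 + t * l) ≠ 0 := by
    intro hc
    nlinarith
  have hsq : 0 < t ^ 2 * (1 + t * v - 2 * ((1 + t * l) * (l - v))) := by
    have h₁ : 0 < (1 + t * v) * (-t - (1 + t * l)) ^ 2 := by positivity
    have h₂ : 0 ≤ (-2 * t - (1 + t * v)) * (1 + t * l) ^ 2 :=
      mul_nonneg (by linarith) (sq_nonneg _)
    linear_combination h₁ + h₂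
  have := pos_of_mul_pos_right hsq (sq_nonneg t)
  rw [div_lt_iff₀ hpos]
  linarith

theorem lam_pos {q : ℕ} (hq : 2 < q) : 0 < lam q := by
  have hq' : (2 : ℝ) < q := by exact_mod_cast hq
  have : 0 < Real.cos (Real.pi / q) := by
    apply Real.cos_pos_of_mem_Ioo
    constructor
    · linarith [Real.pi_pos, (by positivity : 0 ≤ Real.pi / q)]
    · exact div_lt_div_of_pos_left Real.pi_pos two_pos hq'
  unfold lam
  positivity

theorem lam_le_two (q : ℕ) : lam q ≤ 2 := by
  unfold lam
  linarith [Real.cos_le_one (Real.pi / q)]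

/-- on region `B ⊆ D` one has `Θ_{n+1} < 1/2` (even case). -/
theorem theta_on_B_even (q p : ℕ) (hp : 2 ≤ p) (hq : q = 2 * p) (z : ℝ × ℝ)
    (hz : z ∈ DE (lam q) p)
    (h1 : -1 / lam q ≤ z.1) (h2 : z.1 < -2 / (3 * lam q)) :
    (1 + z.1 * lam q) * (lam q - z.2) / (1 + z.1 * z.2) < 1 / 2 := by
  exact future_coefficient_lt_half (lam_pos (by omega)) (lam_le_two q) h2 hz.2.2

end RosenTong
end
end

section
/- Fix an even integer q = 2p with p ≥ 3 and let λ = 2·cos(π/q). The map (t,v) ↦ (−1/t − 2λ, 1/(2λ − v)) is a bijection from A = {(t,v) : −2/(3λ) ≤ t ≤ −1/(λ+1), −2 − 1/t < v ≤ λ−1} onto D_1 = {(t,v) : −λ/2 ≤ t ≤ 1−λ, 1/(2−t) < v ≤ 1/(λ+1)}. Moreover, on A this map coincides with the natural extension map 𝒯 (on A one has r(t) = 2 and ε(t) = −1), so 𝒯 maps A bijectively onto D_1. -/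
noncomputable section

open Real Filter Topology MeasureTheory
open scoped Classical

namespace RosenTong

/-- For `q ≥ 4` one has `1 < λ_q`. -/
theorem one_lt_lam {q : ℕ} (hq : 4 ≤ q) : 1 < lam q := by
  have hq' : (4 : ℝ) ≤ q := by exact_mod_cast hq
  have hpi := Real.pi_pos
  have h0 : 0 < Real.pi / q := by positivity
  have h3 : Real.pi / q < Real.pi / 3 :=
    div_lt_div_of_pos_left hpi (by norm_num) (by linarith)
  have hlow : Real.cos (Real.pi / 3) < Real.cos (Real.pi / q) :=
    Real.cos_lt_cos_of_nonneg_of_le_pi h0.le (by linarith) h3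
  rw [Real.cos_pi_div_three] at hlow
  unfold lam
  linarith

/-- Bounds on `-1/t` for `t` in the base of `A`. -/
theorem neg_one_div_bounds {l t : ℝ} (hl : 0 < l) (h1 : -2 / (3 * l) ≤ t)
    (h2 : t ≤ -1 / (l + 1)) : t < 0 ∧ 3 * l / 2 ≤ -1 / t ∧ -1 / t ≤ l + 1 := by
  have ht : t < 0 := h2.trans_lt (div_neg_of_neg_of_pos (by norm_num) (by linarith))
  rw [div_le_iff₀ (by positivity)] at h1
  rw [le_div_iff₀ (by positivity)] at h2
  refine ⟨ht, ?_, ?_⟩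
  · rw [le_div_iff_of_neg ht]
    linarith
  · rw [div_le_iff_of_neg ht]
    linarith

/-- The Möbius form of the natural extension is a bijection between the two regions. -/
theorem bijOn_moebius {l : ℝ} (hl : 0 < l) :
    Set.BijOn (fun z : ℝ × ℝ => (-1 / z.1 - 2 * l, 1 / (2 * l - z.2)))
      {z : ℝ × ℝ |
        -2 / (3 * l) ≤ z.1 ∧ z.1 ≤ -1 / (l + 1) ∧ -2 - 1 / z.1 < z.2 ∧ z.2 ≤ l - 1}
      {z : ℝ × ℝ |
        -(l / 2) ≤ z.1 ∧ z.1 ≤ 1 - l ∧ 1 / (2 - z.1) < z.2 ∧ z.2 ≤ 1 / (l + 1)} := by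
  refine Set.InvOn.bijOn (f' := fun z : ℝ × ℝ => (-1 / (z.1 + 2 * l), 2 * l - 1 / z.2))
    ⟨?_, ?_⟩ ?_ ?_
  · rintro ⟨t, v⟩ -
    ext
    · simp [neg_div]
    · simp
  · rintro ⟨s, w⟩ -
    ext
    · simp [neg_div]
    · simp
  · rintro ⟨t, v⟩ ⟨h1, h2, h3, h4⟩
    simp only at h1 h2 h3 h4
    obtain ⟨-, hlow, hup⟩ := neg_one_div_bounds hl h1 h2
    have hneg : -1 / t = -(1 / t) := neg_div t 1
    refine ⟨by simp only; linarith, by simp only; linarith, ?_, ?_⟩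
    · exact one_div_lt_one_div_of_lt (by linarith) (by linarith)
    · exact one_div_le_one_div_of_le (by linarith) (by linarith)
  · rintro ⟨s, w⟩ ⟨h1, h2, h3, h4⟩
    simp only at h1 h2 h3 h4
    have hs : 0 < 2 - s := by linarith
    have hw : 0 < w := (one_div_pos.2 hs).trans h3
    have hs' : 0 < s + 2 * l := by linarith
    have hw1 : 1 / w < 2 - s := (one_div_lt hs hw).1 h3
    have hw2 : l + 1 ≤ 1 / w := (le_one_div hw (by linarith)).1 h4
    refine ⟨?_, ?_, ?_, ?_⟩
    · simp only
      rw [div_le_div_iff₀ (by positivity) hs']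
      linarith
    · simp only
      rw [div_le_div_iff₀ hs' (by positivity)]
      linarith
    · have hinv : 1 / (-1 / (s + 2 * l)) = -(s + 2 * l) := by simp [neg_div]
      simp only [hinv]
      linarith
    · simp only
      linarith

/-- The Rosen digit is `2` on the base of `A`. -/
theorem floor_digit_eq_two {l t : ℝ} (hl : 1 < l) (h1 : -2 / (3 * l) ≤ t)
    (h2 : t ≤ -1 / (l + 1)) : ⌊1 / (l * |t|) + 1 / 2⌋ = 2 := by
  have hl0 : 0 < l := by linarith
  obtain ⟨ht, hlow, hup⟩ := neg_one_div_bounds hl0 h1 h2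
  have heq : 1 / (l * |t|) = (-1 / t) / l := by
    rw [abs_of_neg ht]
    field_simp
  have hlow' : 3 / 2 ≤ (-1 / t) / l := by
    rw [le_div_iff₀ hl0]
    linarith
  have hup' : (-1 / t) / l < 5 / 2 := by
    rw [div_lt_iff₀ hl0]
    linarith
  rw [heq, Int.floor_eq_iff]
  push_cast
  constructor <;> linarith

/-- On the base of `A` the natural extension map has Möbius form. -/
theorem T_eq_moebius {l : ℝ} (hl : 1 < l) {z : ℝ × ℝ} (h1 : -2 / (3 * l) ≤ z.1)
    (h2 : z.1 ≤ -1 / (l + 1)) :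
    T l z = (-1 / z.1 - 2 * l, 1 / (2 * l - z.2)) := by
  obtain ⟨ht, -, -⟩ := neg_one_div_bounds (by linarith) h1 h2
  have hf := floor_digit_eq_two hl h1 h2
  unfold T f
  rw [hf, if_neg ht.ne, abs_of_neg ht, Real.sign_of_neg ht]
  ext
  · simp only [div_neg, neg_div]
    push_cast
    ring
  · simp only
    push_cast
    ring

/-- `𝒯` maps `A` bijectively onto `D₁` (even case). -/
theorem T_bijOn_A_D1_even (q p : ℕ) (hp : 3 ≤ p) (hq : q = 2 * p)
    (A D1 : Set (ℝ × ℝ))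
    (hA : A = {z : ℝ × ℝ |
      -2 / (3 * lam q) ≤ z.1 ∧ z.1 ≤ -1 / (lam q + 1) ∧ -2 - 1 / z.1 < z.2 ∧ z.2 ≤ lam q - 1})
    (hD1 : D1 = {z : ℝ × ℝ |
      -(lam q / 2) ≤ z.1 ∧ z.1 ≤ 1 - lam q ∧ 1 / (2 - z.1) < z.2 ∧ z.2 ≤ 1 / (lam q + 1)}) :
    Set.BijOn (fun z : ℝ × ℝ => (-1 / z.1 - 2 * lam q, 1 / (2 * lam q - z.2))) A D1 ∧
    (∀ z ∈ A, (⌊1 / (lam q * |z.1|) + 1 / 2⌋ : ℝ) = 2 ∧ Real.sign z.1 = -1 ∧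
        T (lam q) z = (-1 / z.1 - 2 * lam q, 1 / (2 * lam q - z.2))) ∧
    Set.BijOn (T (lam q)) A D1 := by
  have hl1 : 1 < lam q := one_lt_lam (by omega)
  have hbij := bijOn_moebius (l := lam q) (by linarith)
  subst hA hD1
  refine ⟨hbij, ?_, ?_⟩
  · rintro z ⟨h1, h2, -, -⟩
    refine ⟨by rw [floor_digit_eq_two hl1 h1 h2]; norm_num, ?_, T_eq_moebius hl1 h1 h2⟩
    exact Real.sign_of_neg (neg_one_div_bounds (by linarith) h1 h2).1
  · refine hbij.congr ?_
    rintro z ⟨h1, h2, -, -⟩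
    exact (T_eq_moebius hl1 h1 h2).symm

end RosenTong
end
end

section
/- Fix an even integer q = 2p with p ≥ 3 and let λ = 2·cos(π/q). Then ∫_{t = −2/(3λ)}^{−1/(λ+1)} ∫_{v = −2−1/t}^{λ−1} (1 + tv)^{−2} dv dt = (λ−2)/4 + log(4/(λ+2)). Consequently ν(A) = (1/log((1 + λ/2)/sin(π/q))) · ((λ−2)/4 + log(4/(λ+2))), where A = {(t,v) ∈ D : −2/(3λ) ≤ t ≤ −1/(λ+1)}. -/
noncomputable section

open Real Filter Topology MeasureTheory
open scoped Classical

namespace RosenTong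

/-- On the branch `⌊1 / (λ|x|) + 1/2⌋ = 1`, for negative `x`, the Rosen map is `x ↦ -1/x - λ`. -/
lemma f_of_neg_s14 {l x : ℝ} (hl : 0 < l) (hl2 : l ≤ 2) (hx1 : 1 ≤ l * -x) (hx2 : -x ≤ 1) :
    f l x = 1 / (-x) - l := by
  have hx : 0 < -x := by
    by_contra h
    nlinarith
  have hfloor : ⌊1 / (l * |x|) + 1 / 2⌋ = 1 := by
    rw [abs_of_neg (by linarith), Int.floor_eq_iff]
    have h1 : 1 / (l * -x) ≤ 1 := by
      rw [div_le_one (by linarith)]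
      exact hx1
    have h2 : 1 / 2 ≤ 1 / (l * -x) := by
      apply one_div_le_one_div_of_le (by linarith)
      nlinarith
    constructor <;> push_cast <;> linarith
  rw [f, if_neg (by linarith), hfloor, abs_of_neg (by linarith)]
  simp

lemma cos_nat_mul_pos {θ : ℝ} {p j : ℕ} (hθ : 0 < θ) (hpθ : p * θ = π / 2) (hj : j < p) :
    0 < Real.cos (j * θ) := by
  have : (j : ℝ) * θ < p * θ := by gcongr
  exact Real.cos_pos_of_mem_Ioo ⟨by linarith [mul_nonneg j.cast_nonneg hθ.le, Real.pi_pos],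
    by linarith⟩

lemma one_le_two_cos_mul {θ : ℝ} {p j : ℕ} (hθ : 0 < θ) (hpθ : p * θ = π / 2) (hj : j + 2 ≤ p) :
    1 ≤ 2 * Real.cos θ * (Real.cos ((j + 1 : ℕ) * θ) / Real.cos (j * θ)) := by
  have h0 := cos_nat_mul_pos hθ hpθ (show j < p by lia)
  have h2 : 0 ≤ Real.cos ((j + 2 : ℕ) * θ) := by
    have : ((j + 2 : ℕ) : ℝ) * θ ≤ p * θ := by gcongr
    exact Real.cos_nonneg_of_mem_Icc
      ⟨by linarith [mul_nonneg (j + 2).cast_nonneg hθ.le, Real.pi_pos], by linarith⟩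
  rw [← mul_div_assoc, le_div_iff₀ h0]
  have e0 : (j : ℝ) * θ = (j + 1 : ℕ) * θ - θ := by push_cast; ring
  have e2 : ((j + 2 : ℕ) : ℝ) * θ = (j + 1 : ℕ) * θ + θ := by push_cast; ring
  rw [e2, Real.cos_add] at h2
  rw [e0, Real.cos_sub]
  linarith

lemma phi_eq {θ : ℝ} {p : ℕ} (hp : 2 ≤ p) (hθ : 0 < θ) (hpθ : p * θ = π / 2) :
    ∀ j : ℕ, j < p →
      phi (2 * Real.cos θ) j = -(Real.cos ((j + 1 : ℕ) * θ) / Real.cos (j * θ))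
  | 0, _ => by simp [phi]
  | j + 1, hj => by
    have hcθ := cos_nat_mul_pos hθ hpθ (show 1 < p by lia)
    rw [Nat.cast_one, one_mul] at hcθ
    have h0 := cos_nat_mul_pos hθ hpθ (show j < p by lia)
    have h1 := cos_nat_mul_pos hθ hpθ hj
    have hle : Real.cos ((j + 1 : ℕ) * θ) ≤ Real.cos (j * θ) := by
      have hub : ((j + 1 : ℕ) : ℝ) * θ ≤ p * θ := by gcongr
      apply Real.cos_le_cos_of_nonneg_of_le_pi (by positivity) (by linarith [Real.pi_pos])
      gcongr
      lia
    have ih := phi_eq hp hθ hpθ j (by lia)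
    have hstep : phi (2 * Real.cos θ) (j + 1)
        = f (2 * Real.cos θ) (phi (2 * Real.cos θ) j) := by
      simp only [phi, Function.iterate_succ_apply']
    rw [hstep, ih, f_of_neg_s14 (by linarith) (by linarith [Real.cos_le_one θ])
      (by rw [neg_neg]; exact one_le_two_cos_mul hθ hpθ (by lia))
      (by rw [neg_neg, div_le_one h0]; exact hle)]
    have e0 : (j : ℝ) * θ = (j + 1 : ℕ) * θ - θ := by push_cast; ring
    have e2 : ((j + 1 + 1 : ℕ) : ℝ) * θ = (j + 1 : ℕ) * θ + θ := by push_cast; ring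
    rw [neg_neg, one_div_div, e0, e2, Real.cos_sub, Real.cos_add]
    field_simp
    ring

lemma sin_nat_mul_pos {θ : ℝ} {p j : ℕ} (hθ : 0 < θ) (hpθ : p * θ = π / 2) (hj : 0 < j)
    (hjp : j ≤ p) : 0 < Real.sin (j * θ) := by
  have : (j : ℝ) * θ ≤ p * θ := by gcongr
  have hj' : (0 : ℝ) < j := by exact_mod_cast hj
  exact Real.sin_pos_of_pos_of_lt_pi (by positivity) (by linarith [Real.pi_pos])

lemma LE_eq {θ : ℝ} {p : ℕ} (hθ : 0 < θ) (hpθ : p * θ = π / 2) :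
    ∀ j : ℕ, j + 1 < p → LE (2 * Real.cos θ) (j + 1) =
      (Real.sin ((j + 1 : ℕ) * θ) + Real.sin (j * θ)) /
        (Real.sin ((j + 2 : ℕ) * θ) + Real.sin ((j + 1 : ℕ) * θ))
  | 0, hj => by
    have h1 := sin_nat_mul_pos hθ hpθ one_pos (show 1 ≤ p by lia)
    have h2 := sin_nat_mul_pos hθ hpθ two_pos (show 2 ≤ p by lia)
    have hc := cos_nat_mul_pos hθ hpθ hj
    simp only [zero_add, Nat.cast_one, one_mul, Nat.cast_ofNat] at h1 h2 hc
    simp only [LE, zero_add, Nat.cast_one, one_mul, Nat.cast_ofNat, Nat.cast_zero, zero_mul,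
      Real.sin_zero, add_zero, Real.sin_two_mul]
    field_simp
  | j + 1, hj => by
    have h1 := sin_nat_mul_pos hθ hpθ j.succ_pos (show j + 1 ≤ p by lia)
    have h2 := sin_nat_mul_pos hθ hpθ (j + 1).succ_pos (show j + 2 ≤ p by lia)
    have h3 := sin_nat_mul_pos hθ hpθ (j + 2).succ_pos (show j + 3 ≤ p by lia)
    have ih := LE_eq hθ hpθ j (by lia)
    simp only [Nat.succ_eq_add_one] at h1 h2 h3
    rw [LE, ih]
    simp only [show j + 1 + 1 = j + 2 from rfl, show j + 1 + 2 = j + 3 from rfl] at h1 h2 h3 ⊢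
    have key : 2 * Real.cos θ - (Real.sin ((j + 1 : ℕ) * θ) + Real.sin (j * θ)) /
        (Real.sin ((j + 2 : ℕ) * θ) + Real.sin ((j + 1 : ℕ) * θ)) =
        (Real.sin ((j + 3 : ℕ) * θ) + Real.sin ((j + 2 : ℕ) * θ)) /
        (Real.sin ((j + 2 : ℕ) * θ) + Real.sin ((j + 1 : ℕ) * θ)) := by
      rw [eq_div_iff (by positivity), sub_mul, div_mul_cancel₀ _ (by positivity)]
      have e0 : (j : ℝ) * θ = (j + 1 : ℕ) * θ - θ := by push_cast; ring
      have e1 : Real.sin ((j + 1 : ℕ) * θ) = Real.sin ((j + 2 : ℕ) * θ - θ) := by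
        congr 1; push_cast; ring
      have e2 : Real.sin ((j + 2 : ℕ) * θ) = Real.sin ((j + 1 : ℕ) * θ + θ) := by
        congr 1; push_cast; ring
      have e3 : Real.sin ((j + 3 : ℕ) * θ) = Real.sin ((j + 2 : ℕ) * θ + θ) := by
        congr 1; push_cast; ring
      rw [Real.sin_sub] at e1
      rw [Real.sin_add] at e2 e3
      rw [e0, Real.sin_sub, e3]
      linear_combination -e2 - e1
    rw [key, one_div_div]

lemma LE_sub_one {θ : ℝ} {p : ℕ} (hp : 2 ≤ p) (hθ : 0 < θ) (hpθ : p * θ = π / 2) :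
    LE (2 * Real.cos θ) (p - 1) = 2 * Real.cos θ - 1 := by
  obtain ⟨j, rfl⟩ : ∃ j, p = j + 2 := ⟨p - 2, by lia⟩
  rw [show j + 2 - 1 = j + 1 from rfl, LE_eq hθ hpθ j (by lia), hpθ]
  have hc := cos_nat_mul_pos hθ hpθ (show 1 < j + 2 by lia)
  rw [Nat.cast_one, one_mul] at hc
  have e1 : ((j + 1 : ℕ) : ℝ) * θ = π / 2 - θ := by rw [← hpθ]; push_cast; ring
  have e0 : (j : ℝ) * θ = π / 2 - 2 * θ := by rw [← hpθ]; push_cast; ring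
  rw [e1, e0, Real.sin_pi_div_two_sub, Real.sin_pi_div_two_sub, Real.sin_pi_div_two,
    Real.cos_two_mul]
  field_simp
  ring

lemma mem_OmegaE_iff {θ t v : ℝ} {p : ℕ} (hp : 2 ≤ p) (hθ : 0 < θ) (hpθ : p * θ = π / 2)
    (ht : -1 / (2 * Real.cos θ) < t) (ht0 : t < 0) :
    (t, v) ∈ OmegaE (2 * Real.cos θ) p ↔ 0 ≤ v ∧ v ≤ 2 * Real.cos θ - 1 := by
  have hc := cos_nat_mul_pos hθ hpθ (show 1 < p by lia)
  rw [Nat.cast_one, one_mul] at hc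
  have hphi : ∀ j, j + 2 ≤ p → phi (2 * Real.cos θ) j < t := by
    intro j hj
    refine lt_of_le_of_lt ?_ ht
    rw [phi_eq hp hθ hpθ j (by lia), neg_div, neg_le_neg_iff, div_le_iff₀ (by linarith), mul_comm]
    exact one_le_two_cos_mul hθ hpθ hj
  have hlast : phi (2 * Real.cos θ) (p - 1) = 0 := by
    rw [phi_eq hp hθ hpθ (p - 1) (by lia), Nat.sub_add_cancel (by lia), hpθ]
    simp
  simp only [OmegaE, Set.mem_union, Set.mem_iUnion, Set.mem_prod, Set.mem_Ico, Set.mem_Icc,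
    Finset.mem_Icc, exists_prop]
  constructor
  · rintro (⟨j, ⟨hj1, hj2⟩, ⟨_, h2⟩, h3, h4⟩ | ⟨⟨h, _⟩, _⟩)
    · have hj : j = p - 1 := by
        by_contra hne
        linarith [hphi j (by lia)]
      rw [hj, LE_sub_one hp hθ hpθ] at h4
      exact ⟨h3, h4⟩
    · linarith
  · rintro ⟨h1, h2⟩
    refine Or.inl ⟨p - 1, ⟨by lia, le_rfl⟩, ⟨(hphi _ (by lia)).le, by rwa [hlast]⟩, h1, ?_⟩
    rwa [LE_sub_one hp hθ hpθ]

lemma one_add_mul_pos {b t v : ℝ} (ht : t < 0) (hb : 0 < 1 + t * b)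
    (hv : v ≤ b) : 0 < 1 + t * v := by
  nlinarith

lemma neg_two_sub_le {l t : ℝ} (hl : 0 < l) (ht : t ≤ -1 / (l + 1)) : -2 - 1 / t ≤ l - 1 := by
  rw [le_div_iff₀ (by linarith)] at ht
  have ht0 : t < 0 := by
    by_contra h
    nlinarith
  have : -(l + 1) ≤ 1 / t := by
    rw [le_div_iff_of_neg ht0]
    linarith
  linarith

/-- The region `A` lies between two graphs over `[-2/(3λ), -1/(λ+1)]`. -/
lemma mem_AE_iff {θ t v : ℝ} {p : ℕ} (hp : 2 ≤ p) (hθ : 0 < θ) (hpθ : p * θ = π / 2)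
    (hl3 : 3 ≤ (2 * Real.cos θ) ^ 2) (hl0 : 0 < 2 * Real.cos θ) (hl2 : 2 * Real.cos θ < 2) :
    (t, v) ∈ AE (2 * Real.cos θ) p ↔
      t ∈ Set.Icc (-2 / (3 * (2 * Real.cos θ))) (-1 / (2 * Real.cos θ + 1)) ∧
        v ∈ Set.Ioc (-2 - 1 / t) (2 * Real.cos θ - 1) := by
  set l := 2 * Real.cos θ with hl
  rw [AE, DE, Set.mem_sep_iff, Set.mem_sep_iff, Set.mem_Icc, Set.mem_Ioc]
  dsimp only
  rw [and_comm]
  refine and_congr_right ?_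
  rintro ⟨h1, h2⟩
  have h1' : -1 / l < t := by
    refine lt_of_lt_of_le ?_ h1
    rw [div_lt_div_iff₀ hl0 (by linarith)]
    linarith
  rw [div_le_iff₀ (by linarith)] at h1
  rw [le_div_iff₀ (by linarith)] at h2
  have ht0 : t < 0 := by
    by_contra h
    nlinarith
  rw [mem_OmegaE_iff hp hθ hpθ h1' ht0, ← hl]
  have hlb : 17 / 10 < l := by nlinarith
  have ht : -(2 / 5) < t := by nlinarith
  have hb : 0 < 1 + t * (l - 1) := by nlinarith
  have hcond : -2 - 1 / t < v ↔ 1 + t * v < -2 * t := by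
    rw [sub_lt_comm, lt_div_iff_of_neg ht0]
    constructor <;> intro h <;> linarith
  rw [hcond]
  constructor
  · rintro ⟨⟨_, hv⟩, _, h⟩
    rw [gt_iff_lt, lt_div_iff₀ (one_add_mul_pos ht0 hb hv), abs_of_neg ht0] at h
    exact ⟨by linarith, hv⟩
  · rintro ⟨h, hv⟩
    have hpos := one_add_mul_pos ht0 hb hv
    have hv1 : 1 + t * v < 2 * v := by
      by_contra! hcon
      nlinarith
    refine ⟨⟨by linarith, hv⟩, ?_, ?_⟩
    · rw [gt_iff_lt, lt_div_iff₀ hpos]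
      linarith
    · rw [gt_iff_lt, lt_div_iff₀ hpos, abs_of_neg ht0]
      linarith

lemma continuousOn_density {b t : ℝ} (ht : t < 0) (hb : 0 < 1 + t * b) :
    ContinuousOn (fun v => (1 + t * v) ^ (-2 : ℤ)) (Set.Iic b) := by
  apply ContinuousOn.zpow₀ (by fun_prop)
  intro v hv
  exact Or.inl (one_add_mul_pos ht hb hv).ne'

lemma integral_density {a b t : ℝ} (ht : t < 0) (hb : 0 < 1 + t * b) (hab : a ≤ b) :
    ∫ v in a..b, (1 + t * v) ^ (-2 : ℤ) = b / (1 + t * b) - a / (1 + t * a) := by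
  have hsub : Set.uIcc a b ⊆ Set.Iic b := by
    rw [Set.uIcc_of_le hab]
    exact Set.Icc_subset_Iic_self
  apply intervalIntegral.integral_eq_sub_of_hasDerivAt (f := fun v => v / (1 + t * v))
  · intro v hv
    have hpos := one_add_mul_pos ht hb (hsub hv)
    have h := (hasDerivAt_id v).div (((hasDerivAt_id v).const_mul t).const_add 1) hpos.ne'
    refine h.congr_deriv ?_
    rw [zpow_neg, id, eq_comm, inv_eq_one_div]
    norm_cast
    congr 1
    ring
  · exact ((continuousOn_density ht hb).mono hsub).intervalIntegrable

lemma one_add_mul_sub_one_pos {l t : ℝ} (hl : 0 < l) (ht0 : t < 0) (ht : -2 / (3 * l) ≤ t) :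
    0 < 1 + t * (l - 1) := by
  rw [div_le_iff₀ (by linarith)] at ht
  nlinarith

lemma neg_of_mem {l t : ℝ} (hl : 0 < l) (ht : t ≤ -1 / (l + 1)) : t < 0 :=
  ht.trans_lt (div_neg_of_neg_of_pos (by norm_num) (by linarith))

lemma integral_density_fiber {l t : ℝ} (hl : 0 < l)
    (ht : t ∈ Set.Icc (-2 / (3 * l)) (-1 / (l + 1))) :
    ∫ v in (-2 - 1 / t)..(l - 1), (1 + t * v) ^ (-2 : ℤ) =
      (l - 1) / (1 + t * (l - 1)) - 1 / t - 1 / (2 * t ^ 2) := by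
  have ht0 := neg_of_mem hl ht.2
  rw [integral_density ht0 (one_add_mul_sub_one_pos hl ht0 ht.1) (neg_two_sub_le hl ht.2)]
  have hne := ht0.ne
  have h : 1 + t * (-2 - 1 / t) = -(2 * t) := by
    rw [mul_sub, mul_one_div_cancel hne]
    ring
  rw [h]
  field_simp
  ring

lemma left_le_right {l : ℝ} (hl : 0 < l) (hl2 : l < 2) : -2 / (3 * l) ≤ -1 / (l + 1) := by
  rw [div_le_div_iff₀ (by linarith) (by linarith)]
  linarith

lemma continuousOn_fiber {l : ℝ} (hl : 0 < l) :
    ContinuousOn (fun t => (l - 1) / (1 + t * (l - 1)) - 1 / t - 1 / (2 * t ^ 2))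
      (Set.Icc (-2 / (3 * l)) (-1 / (l + 1))) := by
  have h0 : ∀ t ∈ Set.Icc (-2 / (3 * l)) (-1 / (l + 1)), t ≠ 0 :=
    fun t ht => (neg_of_mem hl ht.2).ne
  have h1 : ∀ t ∈ Set.Icc (-2 / (3 * l)) (-1 / (l + 1)), 1 + t * (l - 1) ≠ 0 :=
    fun t ht => (one_add_mul_sub_one_pos hl (neg_of_mem hl ht.2) ht.1).ne'
  refine ((continuousOn_const.div (by fun_prop) h1).sub
    (continuousOn_const.div (by fun_prop) h0)).sub (continuousOn_const.div (by fun_prop) ?_)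
  intro t ht
  have := h0 t ht
  positivity

lemma integral_fiber {l : ℝ} (hl : 0 < l) (hl2 : l < 2) :
    ∫ t in (-2 / (3 * l))..(-1 / (l + 1)),
        ((l - 1) / (1 + t * (l - 1)) - 1 / t - 1 / (2 * t ^ 2)) =
      (l - 2) / 4 + Real.log (4 / (l + 2)) := by
  have hle := left_le_right hl hl2
  have hF : ∀ t ∈ Set.uIcc (-2 / (3 * l)) (-1 / (l + 1)),
      HasDerivAt (fun t => Real.log (1 + t * (l - 1)) - Real.log t + 1 / 2 * t⁻¹)
        ((l - 1) / (1 + t * (l - 1)) - 1 / t - 1 / (2 * t ^ 2)) t := by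
    intro t ht
    rw [Set.uIcc_of_le hle] at ht
    have ht0 := neg_of_mem hl ht.2
    have hpos := one_add_mul_sub_one_pos hl ht0 ht.1
    have h1 : HasDerivAt (fun t : ℝ => 1 + t * (l - 1)) (l - 1) t := by
      simpa using ((hasDerivAt_id t).mul_const (l - 1)).const_add 1
    have h := ((h1.log hpos.ne').sub (Real.hasDerivAt_log ht0.ne)).add
      ((hasDerivAt_inv ht0.ne).const_mul (1 / 2))
    refine h.congr_deriv ?_
    field_simp
    ring
  rw [intervalIntegral.integral_eq_sub_of_hasDerivAt hF
    (ContinuousOn.intervalIntegrable (by rw [Set.uIcc_of_le hle]; exact continuousOn_fiber hl))]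
  have log_four : Real.log 4 = 2 * Real.log 2 := by
    rw [show (4 : ℝ) = 2 ^ 2 by norm_num, Real.log_pow]
    norm_num
  have e1 : 1 + -1 / (l + 1) * (l - 1) = 2 / (l + 1) := by
    field_simp
    ring
  have e2 : 1 + -2 / (3 * l) * (l - 1) = (l + 2) / (3 * l) := by
    field_simp
    ring
  rw [e1, e2, neg_div, neg_div, Real.log_neg_eq_log, Real.log_neg_eq_log,
    Real.log_div (by norm_num) (by positivity), Real.log_div (by norm_num) (by positivity),
    Real.log_div (by positivity) (by positivity), Real.log_div (by norm_num) (by positivity),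
    Real.log_div (by norm_num) (by positivity), log_four, Real.log_one]
  field_simp
  ring

lemma integral_A {l : ℝ} (hl : 0 < l) (hl2 : l < 2) :
    (∫ t in (-2 / (3 * l))..(-1 / (l + 1)),
        ∫ v in (-2 - 1 / t)..(l - 1), (1 + t * v) ^ (-2 : ℤ)) =
      (l - 2) / 4 + Real.log (4 / (l + 2)) := by
  rw [← integral_fiber hl hl2]
  apply intervalIntegral.integral_congr
  intro t ht
  rw [Set.uIcc_of_le (left_le_right hl hl2)] at ht
  exact integral_density_fiber hl ht

lemma lintegral_density_fiber {c l t : ℝ} (hc : 0 ≤ c) (hl : 0 < l)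
    (ht : t ∈ Set.Icc (-2 / (3 * l)) (-1 / (l + 1))) :
    ∫⁻ v in Set.Ioc (-2 - 1 / t) (l - 1), ENNReal.ofReal (c / (1 + t * v) ^ 2) =
      ENNReal.ofReal (c * ((l - 1) / (1 + t * (l - 1)) - 1 / t - 1 / (2 * t ^ 2))) := by
  have ht0 := neg_of_mem hl ht.2
  have hle := neg_two_sub_le hl ht.2
  have hrw : ∀ v : ℝ, c / (1 + t * v) ^ 2 = c * (1 + t * v) ^ (-2 : ℤ) := fun v => by
    rw [zpow_neg, div_eq_mul_inv]
    norm_cast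
  simp only [hrw]
  rw [← integral_density_fiber hl ht, ← intervalIntegral.integral_const_mul,
    intervalIntegral.integral_of_le hle, ofReal_integral_eq_lintegral_ofReal]
  · refine ((continuousOn_const.mul (continuousOn_density ht0
      (one_add_mul_sub_one_pos hl ht0 ht.1))).mono
        Set.Icc_subset_Iic_self).integrableOn_Icc.mono_set Set.Ioc_subset_Icc_self
  · refine Eventually.of_forall fun v => mul_nonneg hc ?_
    exact Even.zpow_nonneg (by decide) _

lemma fiber_nonneg {l t : ℝ} (hl : 0 < l) (ht : t ∈ Set.Icc (-2 / (3 * l)) (-1 / (l + 1))) :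
    0 ≤ (l - 1) / (1 + t * (l - 1)) - 1 / t - 1 / (2 * t ^ 2) := by
  rw [← integral_density_fiber hl ht]
  exact intervalIntegral.integral_nonneg (neg_two_sub_le hl ht.2)
    fun v _ => Even.zpow_nonneg (by decide) _

lemma lintegral_A {c l : ℝ} (hc : 0 ≤ c) (hl : 0 < l) (hl2 : l < 2) {A : Set (ℝ × ℝ)}
    (hA : ∀ t v, (t, v) ∈ A ↔ t ∈ Set.Icc (-2 / (3 * l)) (-1 / (l + 1)) ∧
      v ∈ Set.Ioc (-2 - 1 / t) (l - 1)) (hAm : MeasurableSet A) :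
    ∫⁻ z in A, ENNReal.ofReal (c / (1 + z.1 * z.2) ^ 2) =
      ENNReal.ofReal (c * ((l - 2) / 4 + Real.log (4 / (l + 2)))) := by
  have hle := left_le_right hl hl2
  rw [← lintegral_indicator hAm, Measure.volume_eq_prod, lintegral_prod _
    (Measurable.aemeasurable (Measurable.indicator (by fun_prop) hAm))]
  have hfib : ∀ t, ∫⁻ v, A.indicator (fun z => ENNReal.ofReal (c / (1 + z.1 * z.2) ^ 2)) (t, v) =
      (Set.Icc (-2 / (3 * l)) (-1 / (l + 1))).indicator (fun t => ENNReal.ofReal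
        (c * ((l - 1) / (1 + t * (l - 1)) - 1 / t - 1 / (2 * t ^ 2)))) t := by
    intro t
    by_cases ht : t ∈ Set.Icc (-2 / (3 * l)) (-1 / (l + 1))
    · rw [Set.indicator_of_mem ht, ← lintegral_density_fiber hc hl ht,
        ← lintegral_indicator measurableSet_Ioc]
      refine lintegral_congr fun v => ?_
      simp only [Set.indicator_apply, hA, ht, true_and]
    · simp [hA, ht]
  rw [lintegral_congr hfib, lintegral_indicator measurableSet_Icc, ← integral_fiber hl hl2,
    ← intervalIntegral.integral_const_mul, intervalIntegral.integral_of_le hle,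
    ← integral_Icc_eq_integral_Ioc, ofReal_integral_eq_lintegral_ofReal]
  · exact (continuousOn_const.mul (continuousOn_fiber hl)).integrableOn_Icc
  · refine (ae_restrict_iff' measurableSet_Icc).2 (Eventually.of_forall fun t ht => ?_)
    exact mul_nonneg hc (fiber_nonneg hl ht)

/-- the measure of the region `A` (even case). -/
theorem measure_A_even (q p : ℕ) (hp : 3 ≤ p) (hq : q = 2 * p) :
    (∫ t in (-2 / (3 * lam q))..(-1 / (lam q + 1)),
        ∫ v in (-2 - 1 / t)..(lam q - 1), (1 + t * v) ^ (-2 : ℤ)) =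
      (lam q - 2) / 4 + Real.log (4 / (lam q + 2)) ∧
    (nuE q p (AE (lam q) p)).toReal =
      (1 / Real.log ((1 + lam q / 2) / Real.sin (Real.pi / q))) *
        ((lam q - 2) / 4 + Real.log (4 / (lam q + 2))) := by
  set θ : ℝ := π / q with hθ
  have hp' : (3 : ℝ) ≤ p := by exact_mod_cast hp
  have hq' : (q : ℝ) = 2 * p := by exact_mod_cast hq
  have hθ0 : 0 < θ := by
    rw [hθ, hq']
    positivity
  have hpθ : p * θ = π / 2 := by
    rw [hθ, hq']
    field_simp
  have hθ6 : θ ≤ π / 6 := by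
    rw [hθ, hq']
    gcongr
    linarith
  have hlam : lam q = 2 * Real.cos θ := rfl
  have hcos : √3 / 2 ≤ Real.cos θ := by
    rw [← Real.cos_pi_div_six]
    exact Real.cos_le_cos_of_nonneg_of_le_pi hθ0.le (by linarith [Real.pi_pos]) hθ6
  have hs3 : (0 : ℝ) < √3 := by positivity
  have hl0 : 0 < 2 * Real.cos θ := by linarith
  have hl3 : 3 ≤ (2 * Real.cos θ) ^ 2 := by
    nlinarith [Real.sq_sqrt (show (0 : ℝ) ≤ 3 by norm_num)]
  have hl2 : 2 * Real.cos θ < 2 := by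
    have := Real.cos_lt_cos_of_nonneg_of_le_pi le_rfl (by linarith [Real.pi_pos]) hθ0
    rw [Real.cos_zero] at this
    linarith
  rw [hlam]
  refine ⟨integral_A hl0 hl2, ?_⟩
  have hsin : 0 < Real.sin θ :=
    Real.sin_pos_of_pos_of_lt_pi hθ0 (by linarith [Real.pi_pos])
  have hC : 0 ≤ 1 / Real.log ((1 + Real.cos θ) / Real.sin θ) := by
    apply one_div_nonneg.2 (Real.log_nonneg _)
    rw [one_le_div hsin]
    linarith [Real.sin_le_one θ]
  have hA := fun t v => mem_AE_iff (t := t) (v := v) (by lia) hθ0 hpθ hl3 hl0 hl2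
  have hAm : MeasurableSet (AE (2 * Real.cos θ) p) := by
    have hset : AE (2 * Real.cos θ) p =
        {z | -2 / (3 * (2 * Real.cos θ)) ≤ z.1} ∩ {z | z.1 ≤ -1 / (2 * Real.cos θ + 1)} ∩
          ({z | -2 - 1 / z.1 < z.2} ∩ {z | z.2 ≤ 2 * Real.cos θ - 1}) := by
      ext ⟨t, v⟩
      exact hA t v
    rw [hset]
    exact ((measurableSet_le (by fun_prop) (by fun_prop)).inter
      (measurableSet_le (by fun_prop) (by fun_prop))).inter
      ((measurableSet_lt (by fun_prop) (by fun_prop)).inter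
        (measurableSet_le (by fun_prop) (by fun_prop)))
  have hsub : AE (2 * Real.cos θ) p ⊆ OmegaE (2 * Real.cos θ) p := fun z hz => hz.1.1
  have hval : 0 ≤ (2 * Real.cos θ - 2) / 4 + Real.log (4 / (2 * Real.cos θ + 2)) := by
    rw [← integral_fiber hl0 hl2]
    exact intervalIntegral.integral_nonneg (left_le_right hl0 hl2)
      fun t ht => fiber_nonneg hl0 ht
  rw [nuE, hlam, ← hθ, withDensity_apply _ hAm, Measure.restrict_restrict hAm,
    Set.inter_eq_self_of_subset_left hsub, lintegral_A hC hl0 hl2 hA hAm,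
    ENNReal.toReal_ofReal (mul_nonneg hC hval), mul_div_cancel_left₀ _ two_ne_zero]

end RosenTong
end
end
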